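/- arXiv:1412.2561 — 3 statements merged into one kernel-verified Lean document; each statement's English description precedes it below -/
import Mathlib

section
/- Let G be a finite multigraph, t ≥ 1 an integer, and K a field of characteristic 0. For every k ≥ 0, the dimension over K of the k-th graded component of B_G^{F_t} equals the number of t-labeled forests F of G whose weight satisfies ω(F) = t·(e(G) − act_G(F)) − k. -/
open MvPolynomial

namespace ForestAlg

variable {V E : Type*}

/-- Two vertices are directly connected by an edge of `A`. -/
def edgeRel (ends : E → Sym2 V) (A : Finset E) (v w : V) : Prop :=
  ∃ e ∈ A, ends e = s(v, w)

/-- Number of connected components of the spanning subgraph `(V, A)`. -/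
noncomputable def numComponents (ends : E → Sym2 V) (A : Finset E) : ℕ :=
  Nat.card (Quot (edgeRel ends A))

/-- Rank `r(A) = v(G) - c(V,A)`. -/
noncomputable def rank (ends : E → Sym2 V) (A : Finset E) : ℕ :=
  Nat.card V - numComponents ends A

/-- `A` is a subforest (contains no cycle): `|A| = v(G) - c(V,A)`. -/
def IsForest (ends : E → Sym2 V) (A : Finset E) : Prop :=
  A.card + numComponents ends A = Nat.card V

/-- The Tutte polynomial, evaluated at `(x, y)`. -/
noncomputable def tutte [Fintype E] {R : Type*} [CommRing R]
    (ends : E → Sym2 V) (x y : R) : R :=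
  ∑ A ∈ (Finset.univ : Finset E).powerset,
    (x - 1) ^ (rank ends Finset.univ - rank ends A) *
      (y - 1) ^ (A.card - rank ends A)

/-- `e ∉ F` is externally active for the subforest `F` with respect to the linear
order `o`: `F + e` contains a cycle and `e` is the minimal edge of that cycle
(the edges of the unique cycle of `F + e` are those whose removal does not
decrease the rank). -/
def ExtActive [DecidableEq E] (o : LinearOrder E) (ends : E → Sym2 V)
    (F : Finset E) (e : E) : Prop :=
  e ∉ F ∧ ¬ IsForest ends (insert e F) ∧
    ∀ f ∈ insert e F,
      rank ends ((insert e F).erase f) = rank ends (insert e F) → o.le e f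

/-- External activity `act_G(F)`. -/
noncomputable def act [DecidableEq E] (o : LinearOrder E) (ends : E → Sym2 V)
    (F : Finset E) : ℕ :=
  Set.ncard {e : E | ExtActive o ends F e}

/-- `D_I`: number of edges with one endpoint in `I` and the other outside `I`. -/
noncomputable def crossCount {n : ℕ} (ends : E → Sym2 (Fin n))
    (I : Finset (Fin n)) : ℕ :=
  Set.ncard {e : E | (∃ v ∈ ends e, v ∈ I) ∧ ∃ w ∈ ends e, w ∉ I}

/-- The ideal `J_G^{F_t}` generated by `(∑_{i ∈ I} x_i)^{t·D_I + 1}` over nonempty `I`. -/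
noncomputable def forestIdeal (K : Type*) [Field K] {n : ℕ} (t : ℕ)
    (ends : E → Sym2 (Fin n)) : Ideal (MvPolynomial (Fin n) K) :=
  Ideal.span {p | ∃ I : Finset (Fin n), I.Nonempty ∧
    p = (∑ i ∈ I, X i) ^ (t * crossCount ends I + 1)}

/-- The `k`-th graded component of `K[x_1,…,x_n]/J` (for homogeneous `J`):
the image of the degree-`k` homogeneous part in the quotient. -/
noncomputable def gradedPiece (K : Type*) [Field K] {n : ℕ}
    (J : Ideal (MvPolynomial (Fin n) K)) (k : ℕ) :
    Submodule K (MvPolynomial (Fin n) K ⧸ J) :=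
  Submodule.map (Ideal.Quotient.mkₐ K J).toLinearMap
    (homogeneousSubmodule (Fin n) K k)

/-- Dimension of the `k`-th graded component of the quotient. -/
noncomputable def gradedDim (K : Type*) [Field K] {n : ℕ}
    (J : Ideal (MvPolynomial (Fin n) K)) (k : ℕ) : ℕ :=
  Module.finrank K (gradedPiece K J k)


/-- A `t`-labeled forest of `G`: a subforest together with a label in `{1,…,t}`
on each of its edges (the labelling function is `0` off the forest). -/
def LabeledForest (ends : E → Sym2 V) (t : ℕ) : Type _ :=
  {Fl : Finset E × (E → ℕ) // IsForest ends Fl.1 ∧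
    (∀ e ∈ Fl.1, 1 ≤ Fl.2 e ∧ Fl.2 e ≤ t) ∧ ∀ e ∉ Fl.1, Fl.2 e = 0}

/-- The weight `ω(F)` of a `t`-labeled forest: the sum of the labels of its
edges. -/
def weight {t : ℕ} {ends : E → Sym2 V} (F : LabeledForest ends t) : ℕ :=
  ∑ e ∈ F.val.1, F.val.2 e

/-- The underlying subforest of a `t`-labeled forest. -/
def LabeledForest.edges {t : ℕ} {ends : E → Sym2 V} (F : LabeledForest ends t) :
    Finset E :=
  F.val.1

section Derivative

variable {K : Type*} [Field K] {σ : Type*} [DecidableEq σ]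

/-- The derivative of polynomials in the direction of the indicator vector of `I`. -/
noncomputable def indDeriv (K : Type*) [Field K] {σ : Type*} [DecidableEq σ] (I : Finset σ) :
    Derivation K (MvPolynomial σ K) (MvPolynomial σ K) :=
  mkDerivation K fun i => if i ∈ I then 1 else 0

theorem indDeriv_X (I : Finset σ) (i : σ) :
    indDeriv K I (X i) = if i ∈ I then 1 else 0 :=
  mkDerivation_X _ _ _

theorem indDeriv_eq_sum (I : Finset σ) (f : MvPolynomial σ K) :
    indDeriv K I f = ∑ i ∈ I, pderiv i f := by
  have sum_apply (g : MvPolynomial σ K) :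
      (∑ i ∈ I, pderiv i : Derivation K (MvPolynomial σ K) (MvPolynomial σ K)) g
        = ∑ i ∈ I, pderiv i g := by
    rw [← Derivation.coeFnAddMonoidHom_apply, map_sum, Finset.sum_apply]
    rfl
  have : indDeriv K I = ∑ i ∈ I, pderiv i := by
    refine derivation_ext fun i => ?_
    rw [indDeriv_X, sum_apply]
    simp [pderiv_X, Pi.single_apply]
  rw [this, sum_apply]

theorem indDeriv_rename [Fintype σ] (I : Finset σ) (c : σ → σ) (f : MvPolynomial σ K) :
    indDeriv K I (rename c f) = rename c (indDeriv K {i | c i ∈ I} f) := by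
  induction f using MvPolynomial.induction_on with
  | C a => simp
  | add p q hp hq => simp [hp, hq]
  | mul_X p i hp =>
    simp only [map_mul, rename_X, Derivation.leibniz, smul_eq_mul, map_add, hp, indDeriv_X,
      Finset.mem_filter, Finset.mem_univ, true_and]
    split_ifs <;> simp

theorem iterate_indDeriv_rename [Fintype σ] (I : Finset σ) (c : σ → σ) (m : ℕ)
    (f : MvPolynomial σ K) :
    (indDeriv K I)^[m] (rename c f) = rename c ((indDeriv K {i | c i ∈ I})^[m] f) := by
  induction m with
  | zero => rfl
  | succ m ih => rw [Function.iterate_succ_apply', ih, indDeriv_rename,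
      ← Function.iterate_succ_apply' (indDeriv K _)]

/-- The Leibniz rule for iterated derivatives of a product with a linear factor. -/
theorem iterate_derivation_mul {A : Type*} [CommRing A] [Algebra K A] (D : Derivation K A A)
    {y : A} {r : K} (hy : D y = algebraMap K A r) (m : ℕ) (g : A) :
    D^[m + 1] (y * g) = y * D^[m + 1] g + ((m + 1 : ℕ) * r) • D^[m] g := by
  induction m with
  | zero =>
    simp [hy, Algebra.smul_def, mul_comm]
  | succ m ih =>
    rw [Function.iterate_succ_apply', ih, map_add, D.leibniz, hy, D.map_smul,
      ← Function.iterate_succ_apply' D, ← Function.iterate_succ_apply' D]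
    simp only [smul_eq_mul, Algebra.smul_def, map_mul, map_natCast]
    push_cast
    ring

theorem exists_iterate_indDeriv_eq_zero (I : Finset σ) (f : MvPolynomial σ K) :
    ∃ m, (indDeriv K I)^[m] f = 0 := by
  have mono : ∀ {m m' : ℕ} {g : MvPolynomial σ K}, (indDeriv K I)^[m] g = 0 → m ≤ m' →
      (indDeriv K I)^[m'] g = 0 := by
    intro m m' g h hm
    obtain ⟨j, rfl⟩ := Nat.exists_eq_add_of_le' hm
    rw [Function.iterate_add_apply, h, iterate_map_zero]
  induction f using MvPolynomial.induction_on with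
  | C a => exact ⟨1, by simp⟩
  | add p q hp hq =>
    obtain ⟨a, ha⟩ := hp
    obtain ⟨b, hb⟩ := hq
    refine ⟨max a b, ?_⟩
    rw [iterate_map_add, mono ha (le_max_left _ _), mono hb (le_max_right _ _), add_zero]
  | mul_X p i hp =>
    obtain ⟨a, ha⟩ := hp
    refine ⟨a + 1, ?_⟩
    rw [mul_comm, iterate_derivation_mul (indDeriv K I) (r := if i ∈ I then 1 else 0),
      mono ha a.le_succ, ha, mul_zero, smul_zero, add_zero]
    rw [indDeriv_X]
    split_ifs <;> simp

theorem iterate_indDeriv_eq_zero_of_mul [CharZero K] (I : Finset σ) {y g : MvPolynomial σ K}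
    {r : K} (hr : r ≠ 0) (hy : indDeriv K I y = algebraMap K _ r) {m : ℕ}
    (h : (indDeriv K I)^[m + 1] (y * g) = 0) : (indDeriv K I)^[m] g = 0 := by
  classical
  obtain ⟨N, hN⟩ := exists_iterate_indDeriv_eq_zero I g
  have key : ∀ j, (indDeriv K I)^[m + j] g = 0 → (indDeriv K I)^[m] g = 0 := by
    intro j
    induction j with
    | zero => exact id
    | succ j ih =>
      intro hj
      apply ih
      have h1 : (indDeriv K I)^[m + j + 1] (y * g) = 0 := by
        rw [show m + j + 1 = j + (m + 1) by ring, Function.iterate_add_apply, h, iterate_map_zero]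
      rw [iterate_derivation_mul _ hy, add_assoc m j 1, hj, mul_zero, zero_add] at h1
      refine (smul_eq_zero.mp h1).resolve_left (mul_ne_zero ?_ hr)
      exact Nat.cast_ne_zero.mpr (m + j).succ_ne_zero
  apply key N
  rw [Function.iterate_add_apply, hN, iterate_map_zero]

end Derivative

section InverseSystem

variable {K : Type*} [Field K] {σ : Type*}

/-- The edge `e` has one endpoint in `I` and the other one outside `I`. -/
def Crosses (I : Finset σ) (e : Sym2 σ) : Prop :=
  (∃ v ∈ e, v ∈ I) ∧ ∃ w ∈ e, w ∉ I

open scoped Classical in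
/-- The number of edges of the multiset `M` crossing the cut given by `I`. -/
noncomputable def cutSize (M : Multiset (Sym2 σ)) (I : Finset σ) : ℕ :=
  M.countP (Crosses I)

theorem cutSize_cons_of_crosses {I : Finset σ} {e : Sym2 σ} (h : Crosses I e)
    (M : Multiset (Sym2 σ)) : cutSize (e ::ₘ M) I = cutSize M I + 1 := by
  classical
  exact Multiset.countP_cons_of_pos _ h

theorem cutSize_cons_of_not_crosses {I : Finset σ} {e : Sym2 σ} (h : ¬ Crosses I e)
    (M : Multiset (Sym2 σ)) : cutSize (e ::ₘ M) I = cutSize M I := by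
  classical
  exact Multiset.countP_cons_of_neg _ h

theorem X_sub_X_ne_zero {a b : σ} (hab : a ≠ b) : (X a - X b : MvPolynomial σ K) ≠ 0 :=
  sub_ne_zero.mpr fun h => hab (X_injective h)

theorem X_sub_X_isHomogeneous (a b : σ) : (X a - X b : MvPolynomial σ K).IsHomogeneous 1 :=
  (isHomogeneous_X _ _).sub (isHomogeneous_X _ _)

theorem homogeneousComponent_mul_of_isHomogeneous {p q : MvPolynomial σ K} {m : ℕ}
    (hp : p.IsHomogeneous m) (k : ℕ) :
    homogeneousComponent (m + k) (p * q) = p * homogeneousComponent k q := by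
  let : GradedAlgebra (homogeneousSubmodule σ K) := MvPolynomial.gradedAlgebra
  have h := DirectSum.coe_decompose_mul_add_of_left_mem (homogeneousSubmodule σ K) (b := q)
    (j := k) (i := m) (a := p) hp
  have h_comp (f : MvPolynomial σ K) (i : ℕ) :
      (DirectSum.decompose (homogeneousSubmodule σ K) f i : MvPolynomial σ K)
        = homogeneousComponent i f :=
    decomposition.decompose'_apply f i
  rwa [h_comp, h_comp] at h

theorem eq_zero_of_rename_eq_zero {c : σ → σ} {f : MvPolynomial σ K} (hf : f.IsHomogeneous 0)
    (h : rename c f = 0) : f = 0 := by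
  rw [← totalDegree_zero_iff_isHomogeneous, totalDegree_eq_zero_iff_eq_C] at hf
  rw [hf] at h ⊢
  rwa [rename_C] at h

variable [DecidableEq σ]

theorem crosses_mk {I : Finset σ} {a b : σ} :
    Crosses I s(a, b) ↔ (a ∈ I ∧ b ∉ I) ∨ (b ∈ I ∧ a ∉ I) := by
  simp only [Crosses, Sym2.mem_iff, exists_eq_or_imp, exists_eq_left]
  tauto

theorem crosses_map [Fintype σ] {I : Finset σ} {c : σ → σ} {e : Sym2 σ} :
    Crosses I (e.map c) ↔ Crosses {i | c i ∈ I} e := by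
  simp [Crosses]

theorem cutSize_map [Fintype σ] (M : Multiset (Sym2 σ)) (c : σ → σ) (I : Finset σ) :
    cutSize (M.map (Sym2.map c)) I = cutSize M {i | c i ∈ I} := by
  classical
  rw [cutSize, Multiset.countP_map, cutSize, Multiset.countP_eq_card_filter]
  simp only [crosses_map]

/-- The degree `k` part of the Macaulay inverse system of the ideal generated by the powers
`(∑ i ∈ I, x_i) ^ (D_I + 1)`, for the graph with edges `M`. -/
noncomputable def inverseSystem (K : Type*) [Field K] (M : Multiset (Sym2 σ)) (k : ℕ) :
    Submodule K (MvPolynomial σ K) where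
  carrier := {f | f.IsHomogeneous k ∧ ∀ I, (indDeriv K I)^[cutSize M I + 1] f = 0}
  add_mem' hf hg := ⟨hf.1.add hg.1, fun I => by
    rw [iterate_map_add, hf.2, hg.2, add_zero]⟩
  zero_mem' := ⟨isHomogeneous_zero _ _ _, fun I => iterate_map_zero _ _⟩
  smul_mem' r f hf := ⟨(homogeneousSubmodule σ K k).smul_mem r hf.1, fun I => by
    have : ∀ m, (indDeriv K I)^[m] (r • f) = r • (indDeriv K I)^[m] f := by
      intro m
      induction m with
      | zero => rfl
      | succ m ih => simp only [Function.iterate_succ_apply', ih, Derivation.map_smul]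
    rw [this, hf.2, smul_zero]⟩

theorem mem_inverseSystem {M : Multiset (Sym2 σ)} {k : ℕ} {f : MvPolynomial σ K} :
    f ∈ inverseSystem K M k ↔
      f.IsHomogeneous k ∧ ∀ I, (indDeriv K I)^[cutSize M I + 1] f = 0 :=
  Iff.rfl

theorem inverseSystem_congr {M M' : Multiset (Sym2 σ)} (h : ∀ I, cutSize M I = cutSize M' I)
    (k : ℕ) : inverseSystem K M k = inverseSystem K M' k := by
  ext f
  simp only [mem_inverseSystem, h]

theorem inverseSystem_cons_diag (a : σ) (M : Multiset (Sym2 σ)) (k : ℕ) :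
    inverseSystem K (s(a, a) ::ₘ M) k = inverseSystem K M k :=
  inverseSystem_congr (fun I => cutSize_cons_of_not_crosses (by simp [crosses_mk]) M) k

theorem inverseSystem_le_cons (e : Sym2 σ) (M : Multiset (Sym2 σ)) (k : ℕ) :
    inverseSystem K M k ≤ inverseSystem K (e ::ₘ M) k := by
  refine fun f hf => ⟨hf.1, fun I => ?_⟩
  by_cases h : Crosses I e
  · rw [cutSize_cons_of_crosses h, Function.iterate_succ_apply', hf.2, map_zero]
  · rw [cutSize_cons_of_not_crosses h, hf.2]

theorem rename_mem_inverseSystem [Fintype σ] {M : Multiset (Sym2 σ)} {k : ℕ}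
    {f : MvPolynomial σ K} (hf : f ∈ inverseSystem K M k) (c : σ → σ) :
    rename c f ∈ inverseSystem K (M.map (Sym2.map c)) k :=
  ⟨hf.1.rename_isHomogeneous, fun I => by
    rw [iterate_indDeriv_rename, cutSize_map, hf.2, map_zero]⟩

theorem indDeriv_X_sub_X_of_not_crosses {I : Finset σ} {a b : σ} (h : ¬ Crosses I s(a, b)) :
    indDeriv K I (X a - X b) = algebraMap K _ 0 := by
  rw [crosses_mk] at h
  rw [map_sub, indDeriv_X, indDeriv_X]
  by_cases ha : a ∈ I <;> by_cases hb : b ∈ I <;> simp_all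

theorem exists_indDeriv_X_sub_X_of_crosses {I : Finset σ} {a b : σ} (h : Crosses I s(a, b)) :
    ∃ r : K, r ≠ 0 ∧ indDeriv K I (X a - X b) = algebraMap K _ r := by
  rw [crosses_mk] at h
  rw [map_sub, indDeriv_X, indDeriv_X]
  rcases h with h | h
  · exact ⟨1, one_ne_zero, by simp [h.1, h.2]⟩
  · exact ⟨-1, by simp, by simp [h.1, h.2]⟩

theorem X_sub_X_mul_mem_inverseSystem {M : Multiset (Sym2 σ)} {k : ℕ} {g : MvPolynomial σ K}
    (hg : g ∈ inverseSystem K M k) (a b : σ) :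
    (X a - X b) * g ∈ inverseSystem K (s(a, b) ::ₘ M) (k + 1) := by
  refine ⟨add_comm 1 k ▸ (X_sub_X_isHomogeneous a b).mul hg.1, fun I => ?_⟩
  by_cases h : Crosses I s(a, b)
  · obtain ⟨r, -, hr⟩ := exists_indDeriv_X_sub_X_of_crosses (K := K) h
    rw [cutSize_cons_of_crosses h, iterate_derivation_mul _ hr, Function.iterate_succ_apply',
      hg.2, map_zero, mul_zero, smul_zero, add_zero]
  · rw [cutSize_cons_of_not_crosses h,
      iterate_derivation_mul _ (indDeriv_X_sub_X_of_not_crosses h), hg.2, mul_zero, mul_zero,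
      zero_smul, add_zero]

theorem mem_inverseSystem_of_X_sub_X_mul [CharZero K] {M : Multiset (Sym2 σ)} {k : ℕ}
    {g : MvPolynomial σ K} {a b : σ} (hab : a ≠ b) (hg : g.IsHomogeneous k)
    (h : (X a - X b) * g ∈ inverseSystem K (s(a, b) ::ₘ M) (k + 1)) :
    g ∈ inverseSystem K M k := by
  refine ⟨hg, fun I => ?_⟩
  have hI := h.2 I
  by_cases h : Crosses I s(a, b)
  · obtain ⟨r, hr, hy⟩ := exists_indDeriv_X_sub_X_of_crosses (K := K) h
    rw [cutSize_cons_of_crosses h] at hI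
    exact iterate_indDeriv_eq_zero_of_mul I hr hy hI
  · rw [cutSize_cons_of_not_crosses h,
      iterate_derivation_mul _ (indDeriv_X_sub_X_of_not_crosses h), mul_zero, zero_smul,
      add_zero] at hI
    exact (mul_eq_zero.mp hI).resolve_left (X_sub_X_ne_zero hab)

/-- The map contracting `b` onto `a`. -/
def contract (a b : σ) (x : σ) : σ := if x = b then a else x

theorem contract_left (a b : σ) : contract a b a = a := by simp [contract]

theorem contract_right (a b : σ) : contract a b b = a := by simp [contract]

theorem rename_contract_X_sub_X (a b : σ) :
    rename (contract a b) (X a - X b : MvPolynomial σ K) = 0 := by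
  simp [contract_left, contract_right]

theorem X_sub_X_dvd_of_rename_contract_eq_zero {a b : σ} {f : MvPolynomial σ K}
    (h : rename (contract a b) f = 0) : (X a - X b) ∣ f := by
  set y : MvPolynomial σ K := X a - X b with hy
  have key : (Ideal.Quotient.mkₐ K (Ideal.span {y})).comp (rename (contract a b))
      = Ideal.Quotient.mkₐ K (Ideal.span {y}) := by
    refine algHom_ext fun i => ?_
    by_cases hi : i = b
    · subst hi
      simp only [AlgHom.comp_apply, rename_X, contract_right, Ideal.Quotient.mkₐ_eq_mk]
      exact Ideal.Quotient.eq.mpr (Ideal.mem_span_singleton_self _)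
    · simp [contract, hi]
  have h1 := DFunLike.congr_fun key f
  rw [AlgHom.comp_apply, h, map_zero, Ideal.Quotient.mkₐ_eq_mk] at h1
  exact Ideal.mem_span_singleton.mp (Ideal.Quotient.eq_zero_iff_mem.mp h1.symm)

/-- The kernel of the contraction map on the inverse system. -/
theorem exists_of_rename_contract_eq_zero [CharZero K] {M : Multiset (Sym2 σ)} {k : ℕ} {a b : σ}
    (hab : a ≠ b) {f : MvPolynomial σ K} (hf : f ∈ inverseSystem K (s(a, b) ::ₘ M) (k + 1))
    (h : rename (contract a b) f = 0) :
    ∃ g ∈ inverseSystem K M k, (X a - X b) * g = f := by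
  obtain ⟨g, rfl⟩ := X_sub_X_dvd_of_rename_contract_eq_zero h
  have hg : (X a - X b) * homogeneousComponent k g = (X a - X b) * g := by
    rw [← homogeneousComponent_mul_of_isHomogeneous (X_sub_X_isHomogeneous a b), add_comm 1 k]
    exact homogeneousComponent_eq_self hf.1
  refine ⟨homogeneousComponent k g, ?_, hg⟩
  exact mem_inverseSystem_of_X_sub_X_mul hab (homogeneousComponent_isHomogeneous k g)
    (hg.symm ▸ hf)

theorem mem_inverseSystem_zero [CharZero K] [Fintype σ] {k : ℕ} {f : MvPolynomial σ K}
    (hf : f ∈ inverseSystem K (0 : Multiset (Sym2 σ)) k) : ∃ r, f = C r := by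
  refine ⟨coeff 0 f, ?_⟩
  have hd : ∀ i, pderiv i f = 0 := fun i => by
    have := hf.2 {i}
    rwa [cutSize, Multiset.countP_zero, Function.iterate_one, indDeriv_eq_sum,
      Finset.sum_singleton] at this
  ext m
  rw [coeff_C]
  split_ifs with hm
  · rw [hm]
  · obtain ⟨i, hi⟩ := Finsupp.ne_iff.mp (Ne.symm hm)
    have hm' : m = (m - Finsupp.single i 1) + Finsupp.single i 1 :=
      (tsub_add_cancel_of_le (Finsupp.single_le_iff.mpr (Nat.one_le_iff_ne_zero.mpr hi))).symm
    have h1 := congrArg (coeff (m - Finsupp.single i 1)) (hd i)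
    rw [coeff_pderiv, ← hm', coeff_zero] at h1
    refine (mul_eq_zero.mp h1).resolve_right ?_
    exact Nat.cast_add_one_ne_zero _

end InverseSystem

section HilbertSeries

variable {K : Type*} [Field K] {σ : Type*} [DecidableEq σ]

theorem finrank_map_add_finrank_inf_ker {W W' : Type*} [AddCommGroup W] [Module K W]
    [AddCommGroup W'] [Module K W'] (φ : W →ₗ[K] W') (S : Submodule K W)
    [FiniteDimensional K S] :
    Module.finrank K (S.map φ) + Module.finrank K (S ⊓ LinearMap.ker φ : Submodule K W)
      = Module.finrank K S := by
  rw [← LinearMap.finrank_range_add_finrank_ker (φ.domRestrict S), LinearMap.range_domRestrict,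
    LinearMap.ker_domRestrict, ← Submodule.finrank_map_subtype_eq, Submodule.map_comap_subtype]

variable (K) in
/-- The Hilbert series of the inverse system. -/
noncomputable def hilb (M : Multiset (Sym2 σ)) : PowerSeries ℕ :=
  PowerSeries.mk fun k => Module.finrank K (inverseSystem K M k)

theorem hilb_congr {M M' : Multiset (Sym2 σ)} (h : ∀ I, cutSize M I = cutSize M' I) :
    hilb K M = hilb K M' := by
  ext k
  rw [hilb, hilb, PowerSeries.coeff_mk, PowerSeries.coeff_mk, inverseSystem_congr h]

theorem hilb_cons_diag (a : σ) (M : Multiset (Sym2 σ)) :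
    hilb K (s(a, a) ::ₘ M) = hilb K M :=
  hilb_congr fun I => cutSize_cons_of_not_crosses (by simp [crosses_mk]) M

theorem hilb_replicate_diag_add (a : σ) (M : Multiset (Sym2 σ)) (t : ℕ) :
    hilb K (Multiset.replicate t s(a, a) + M) = hilb K M := by
  induction t with
  | zero => simp
  | succ t ih => rw [Multiset.replicate_succ, Multiset.cons_add, hilb_cons_diag, ih]

variable [CharZero K] [Fintype σ]

/-- Any map of vertices induces a surjection between the inverse systems. -/
theorem exists_rename_eq_of_mem_inverseSystem (M : Multiset (Sym2 σ)) :
    ∀ (c : σ → σ) (k : ℕ), ∀ f ∈ inverseSystem K (M.map (Sym2.map c)) k,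
      ∃ g ∈ inverseSystem K M k, rename c g = f := by
  induction M using Multiset.induction with
  | empty =>
    intro c k f hf
    obtain ⟨r, rfl⟩ := mem_inverseSystem_zero hf
    exact ⟨C r, ⟨hf.1, fun I => by simp [cutSize]⟩, rename_C _ _⟩
  | cons e M ih =>
    induction e with
    | h a b =>
    intro c k f hf
    rw [Multiset.map_cons, Sym2.map_mk] at hf
    by_cases hab : c a = c b
    · rw [hab, inverseSystem_cons_diag] at hf
      obtain ⟨g, hg, rfl⟩ := ih c k f hf
      exact ⟨g, inverseSystem_le_cons _ _ _ hg, rfl⟩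
    · have h1 := rename_mem_inverseSystem hf (contract (c a) (c b))
      rw [Multiset.map_cons, Sym2.map_mk, contract_left, contract_right,
        inverseSystem_cons_diag, Multiset.map_map, ← Sym2.map_comp] at h1
      obtain ⟨g, hg, hgf⟩ := ih _ k _ h1
      have h2 : rename (contract (c a) (c b)) (f - rename c g) = 0 := by
        rw [map_sub, rename_rename, hgf, sub_self]
      have h3 : f - rename c g ∈
          inverseSystem K (s(c a, c b) ::ₘ M.map (Sym2.map c)) k :=
        Submodule.sub_mem _ hf (inverseSystem_le_cons _ _ _ (rename_mem_inverseSystem hg c))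
      cases k with
      | zero =>
        exact ⟨g, inverseSystem_le_cons _ _ _ hg,
          (sub_eq_zero.mp (eq_zero_of_rename_eq_zero h3.1 h2)).symm⟩
      | succ k =>
        obtain ⟨q, hq, hqf⟩ := exists_of_rename_contract_eq_zero hab h3 h2
        obtain ⟨p, hp, rfl⟩ := ih c k q hq
        refine ⟨g + (X a - X b) * p, Submodule.add_mem _ (inverseSystem_le_cons _ _ _ hg)
          (X_sub_X_mul_mem_inverseSystem hp a b), ?_⟩
        simp [hqf]

instance (M : Multiset (Sym2 σ)) (k : ℕ) : FiniteDimensional K (inverseSystem K M k) := by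
  have : FiniteDimensional K (homogeneousSubmodule σ K k) :=
    Module.Finite.iff_fg.mpr (homogeneousSubmodule_fg σ K k)
  exact Submodule.finiteDimensional_of_le (S₂ := homogeneousSubmodule σ K k) fun f hf => hf.1

theorem map_rename_inverseSystem (a b : σ) (M : Multiset (Sym2 σ)) (k : ℕ) :
    (inverseSystem K (s(a, b) ::ₘ M) k).map (rename (contract a b) : _ →ₐ[K] _).toLinearMap
      = inverseSystem K (M.map (Sym2.map (contract a b))) k := by
  have h : inverseSystem K (M.map (Sym2.map (contract a b))) k =
      inverseSystem K ((s(a, b) ::ₘ M).map (Sym2.map (contract a b))) k := by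
    rw [Multiset.map_cons, Sym2.map_mk, contract_left, contract_right, inverseSystem_cons_diag]
  rw [h]
  apply le_antisymm
  · rintro _ ⟨f, hf, rfl⟩
    exact rename_mem_inverseSystem hf _
  · intro f hf
    obtain ⟨g, hg, rfl⟩ := exists_rename_eq_of_mem_inverseSystem _ _ _ f hf
    exact ⟨g, hg, rfl⟩

theorem finrank_inverseSystem_zero {a b : σ} (M : Multiset (Sym2 σ)) :
    Module.finrank K (inverseSystem K (s(a, b) ::ₘ M) 0) =
      Module.finrank K (inverseSystem K (M.map (Sym2.map (contract a b))) 0) := by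
  have h : inverseSystem K (s(a, b) ::ₘ M) 0 ⊓
      LinearMap.ker (rename (contract a b) : _ →ₐ[K] _).toLinearMap = ⊥ :=
    (Submodule.eq_bot_iff _).mpr fun f hf => eq_zero_of_rename_eq_zero hf.1.1 hf.2
  rw [← finrank_map_add_finrank_inf_ker (rename (contract a b) : _ →ₐ[K] _).toLinearMap, h,
    map_rename_inverseSystem, finrank_bot, add_zero]

theorem finrank_inverseSystem_succ {a b : σ} (hab : a ≠ b) (M : Multiset (Sym2 σ)) (k : ℕ) :
    Module.finrank K (inverseSystem K (s(a, b) ::ₘ M) (k + 1)) =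
      Module.finrank K (inverseSystem K M k) +
        Module.finrank K (inverseSystem K (M.map (Sym2.map (contract a b))) (k + 1)) := by
  have h : inverseSystem K (s(a, b) ::ₘ M) (k + 1) ⊓
      LinearMap.ker (rename (contract a b) : _ →ₐ[K] _).toLinearMap
        = (inverseSystem K M k).map (LinearMap.mulLeft K (X a - X b)) := by
    apply le_antisymm
    · rintro f ⟨hf, h0⟩
      exact exists_of_rename_contract_eq_zero hab hf h0
    · rintro _ ⟨g, hg, rfl⟩
      refine ⟨X_sub_X_mul_mem_inverseSystem hg a b, ?_⟩
      change rename (contract a b) ((X a - X b) * g) = 0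
      rw [map_mul, rename_contract_X_sub_X, zero_mul]
  rw [← finrank_map_add_finrank_inf_ker (rename (contract a b) : _ →ₐ[K] _).toLinearMap, h,
    map_rename_inverseSystem, add_comm]
  congr 1
  exact (Submodule.equivMapOfInjective _
    (mul_right_injective₀ (X_sub_X_ne_zero hab)) _).finrank_eq.symm

theorem hilb_zero : hilb K (0 : Multiset (Sym2 σ)) = 1 := by
  ext k
  rw [hilb, PowerSeries.coeff_mk, PowerSeries.coeff_one]
  split_ifs with hk
  · subst hk
    have : inverseSystem K (0 : Multiset (Sym2 σ)) 0 = Submodule.span K {1} := by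
      apply le_antisymm
      · intro f hf
        obtain ⟨r, rfl⟩ := mem_inverseSystem_zero hf
        exact Submodule.mem_span_singleton.mpr ⟨r, by rw [smul_eq_C_mul, mul_one]⟩
      · rw [Submodule.span_singleton_le_iff_mem]
        exact ⟨isHomogeneous_one _ _, fun I => by simp [cutSize]⟩
    rw [this, finrank_span_singleton one_ne_zero]
  · have : inverseSystem K (0 : Multiset (Sym2 σ)) k = ⊥ := by
      refine (Submodule.eq_bot_iff _).mpr fun f hf => ?_
      obtain ⟨r, rfl⟩ := mem_inverseSystem_zero hf
      by_contra hr
      exact hk (hf.1.inj_right (isHomogeneous_C _ _) hr)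
    rw [this, finrank_bot]

theorem hilb_cons {a b : σ} (hab : a ≠ b) (M : Multiset (Sym2 σ)) :
    hilb K (s(a, b) ::ₘ M) =
      PowerSeries.X * hilb K M + hilb K (M.map (Sym2.map (contract a b))) := by
  ext k
  cases k with
  | zero => simp [hilb, finrank_inverseSystem_zero]
  | succ k => simp [hilb, finrank_inverseSystem_succ hab, PowerSeries.coeff_succ_X_mul]

theorem hilb_replicate_add {a b : σ} (hab : a ≠ b) (M : Multiset (Sym2 σ)) (t : ℕ) :
    hilb K (Multiset.replicate t s(a, b) + M) =
      PowerSeries.X ^ t * hilb K M +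
        (∑ i ∈ Finset.range t, PowerSeries.X ^ i) *
          hilb K (M.map (Sym2.map (contract a b))) := by
  induction t with
  | zero => simp
  | succ t ih =>
    rw [Multiset.replicate_succ, Multiset.cons_add, hilb_cons hab, ih, Multiset.map_add,
      Multiset.map_replicate, Sym2.map_mk, contract_left, contract_right,
      hilb_replicate_diag_add, Finset.sum_range_succ', pow_zero]
    simp only [pow_succ', ← Finset.mul_sum]
    ring

end HilbertSeries

section Apolarity

variable {K : Type*} [Field K] {σ : Type*} [Fintype σ]

/-- The apolarity pairing `(p, f) ↦ (p(∂) f)(0)`. -/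
noncomputable def apolar (K : Type*) [Field K] (σ : Type*) [Fintype σ] :
    MvPolynomial σ K →ₗ[K] MvPolynomial σ K →ₗ[K] K :=
  (basisMonomials σ K).constr K fun α => (∏ i, ((α i).factorial : K)) • lcoeff K α

theorem apolar_monomial (α : σ →₀ ℕ) (r : K) (f : MvPolynomial σ K) :
    apolar K σ (monomial α r) f = r * ((∏ i, ((α i).factorial : K)) * coeff α f) := by
  have h : monomial α r = r • basisMonomials σ K α := by
    rw [coe_basisMonomials, smul_monomial, smul_eq_mul, mul_one]
  rw [h, apolar, map_smul, Module.Basis.constr_basis]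
  rfl

theorem apolar_X_mul (i : σ) (p f : MvPolynomial σ K) :
    apolar K σ (X i * p) f = apolar K σ p (pderiv i f) := by
  classical
  induction p using MvPolynomial.induction_on' with
  | add p q hp hq => rw [mul_add, map_add, map_add, LinearMap.add_apply, hp, hq, LinearMap.add_apply]
  | monomial α r =>
    rw [X, monomial_mul, one_mul, add_comm, apolar_monomial, apolar_monomial, coeff_pderiv,
      ← Finset.mul_prod_erase _ _ (Finset.mem_univ i),
      ← Finset.mul_prod_erase _ (fun j => ((α j).factorial : K)) (Finset.mem_univ i)]
    have h : ∏ j ∈ Finset.univ.erase i, (((α + Finsupp.single i 1 : σ →₀ ℕ) j).factorial : K)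
        = ∏ j ∈ Finset.univ.erase i, ((α j).factorial : K) :=
      Finset.prod_congr rfl fun j hj => by simp [Finset.ne_of_mem_erase hj]
    rw [h, Finsupp.add_apply, Finsupp.single_eq_same, Nat.factorial_succ]
    push_cast
    ring

theorem apolar_pow_mul [DecidableEq σ] (I : Finset σ) (m : ℕ) (p f : MvPolynomial σ K) :
    apolar K σ ((∑ i ∈ I, X i) ^ m * p) f = apolar K σ p ((indDeriv K I)^[m] f) := by
  induction m generalizing f with
  | zero => simp
  | succ m ih =>
    rw [pow_succ', mul_assoc, Finset.sum_mul, map_sum, LinearMap.sum_apply,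
      Function.iterate_succ_apply, ← ih, indDeriv_eq_sum, map_sum]
    exact Finset.sum_congr rfl fun i _ => apolar_X_mul _ _ _

theorem prod_factorial_ne_zero [CharZero K] (α : σ →₀ ℕ) :
    ∏ i, ((α i).factorial : K) ≠ 0 :=
  Finset.prod_ne_zero_iff.mpr fun _ _ => Nat.cast_ne_zero.mpr (Nat.factorial_ne_zero _)

theorem apolar_apply_monomial_one (p : MvPolynomial σ K) (α : σ →₀ ℕ) :
    apolar K σ p (monomial α 1) = (∏ i, ((α i).factorial : K)) * coeff α p := by
  classical
  induction p using MvPolynomial.induction_on' with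
  | add p q hp hq => rw [map_add, LinearMap.add_apply, hp, hq, coeff_add, mul_add]
  | monomial β r =>
    rw [apolar_monomial, coeff_monomial, coeff_monomial]
    by_cases h : α = β
    · subst h
      simp [mul_comm]
    · rw [if_neg h, if_neg (Ne.symm h)]
      simp

theorem apolar_eq_zero_of_isHomogeneous {p f : MvPolynomial σ K} {j k : ℕ}
    (hp : p.IsHomogeneous j) (hf : f.IsHomogeneous k) (hjk : j ≠ k) : apolar K σ p f = 0 := by
  rw [p.as_sum, map_sum, LinearMap.sum_apply]
  refine Finset.sum_eq_zero fun α hα => ?_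
  rw [apolar_monomial, hf.coeff_eq_zero, mul_zero, mul_zero]
  rintro rfl
  refine hjk (Eq.symm ?_)
  by_contra h
  exact mem_support_iff.mp hα (hp.coeff_eq_zero h)

/-- Macaulay duality: the graded pieces of the quotient by an ideal of powers of linear forms have
the same dimension as those of the inverse system. -/
theorem finrank_gradedPiece_eq [CharZero K] {n : ℕ} {M : Multiset (Sym2 (Fin n))}
    {J : Ideal (MvPolynomial (Fin n) K)}
    (hJ : J = Ideal.span {p | ∃ I : Finset (Fin n), I.Nonempty ∧
      p = (∑ i ∈ I, X i) ^ (cutSize M I + 1)}) (k : ℕ) :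
    gradedDim K J k = Module.finrank K (inverseSystem K M k) := by
  set q := (Ideal.Quotient.mkₐ K J).toLinearMap with hq
  set H := homogeneousSubmodule (Fin n) K k with hH
  have hqJ : ∀ p, p ∈ LinearMap.ker q ↔ p ∈ J := fun p => Ideal.Quotient.eq_zero_iff_mem
  have : FiniteDimensional K H := Module.Finite.iff_fg.mpr (homogeneousSubmodule_fg _ _ _)
  let B : LinearMap.BilinForm K H := (apolar K (Fin n)).domRestrict₁₂ H H
  have hB : LinearMap.ker B = ⊥ := by
    refine (Submodule.eq_bot_iff _).mpr fun p hp => Subtype.ext ?_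
    ext α
    by_contra hα
    have hd : α.degree = k := by
      by_contra h
      exact hα (p.2.coeff_eq_zero h)
    have h0 : apolar K (Fin n) p (monomial α 1) = 0 :=
      LinearMap.congr_fun (LinearMap.mem_ker.mp hp) ⟨_, isHomogeneous_monomial 1 hd⟩
    rw [apolar_apply_monomial_one] at h0
    exact hα ((mul_eq_zero.mp h0).resolve_left (prod_factorial_ne_zero α))
  let W : Submodule K H := (LinearMap.ker q).comap H.subtype
  have hW : (B.orthogonal W).map H.subtype = inverseSystem K M k := by
    ext f
    constructor
    · rintro ⟨f, hf, rfl⟩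
      refine ⟨f.2, fun I => ?_⟩
      rcases I.eq_empty_or_nonempty with rfl | hI
      · rw [Function.iterate_succ_apply, indDeriv_eq_sum, Finset.sum_empty, iterate_map_zero]
      ext α
      rw [coeff_zero]
      refine (mul_eq_zero.mp ?_).resolve_left (prod_factorial_ne_zero (K := K) α)
      rw [← one_mul (_ * _), ← apolar_monomial, ← apolar_pow_mul]
      have hl : ((∑ i ∈ I, X i : MvPolynomial (Fin n) K) ^ (cutSize M I + 1) *
          monomial α 1).IsHomogeneous (1 * (cutSize M I + 1) + α.degree) :=
        ((IsHomogeneous.sum _ _ _ fun i _ => isHomogeneous_X _ i).pow _).mul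
          (isHomogeneous_monomial _ rfl)
      by_cases hk : 1 * (cutSize M I + 1) + α.degree = k
      · rw [hk] at hl
        refine hf ⟨_, hl⟩ ((hqJ _).mpr (J.mul_mem_right _ ?_))
        rw [hJ]
        exact Ideal.subset_span ⟨I, hI, rfl⟩
      · exact apolar_eq_zero_of_isHomogeneous hl f.2 hk
    · intro hf
      refine ⟨⟨f, hf.1⟩, ?_, rfl⟩
      have key : ∀ p ∈ J, ∀ r, apolar K (Fin n) (r * p) f = 0 := by
        intro p hp
        rw [hJ] at hp
        induction hp using Submodule.span_induction with
        | mem x hx =>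
          obtain ⟨I, -, rfl⟩ := hx
          intro r
          rw [mul_comm, apolar_pow_mul, hf.2, map_zero]
        | zero => simp
        | add x y _ _ hx hy =>
          intro r
          rw [mul_add, map_add, LinearMap.add_apply, hx, hy, add_zero]
        | smul s x _ hx =>
          intro r
          rw [smul_eq_mul, ← mul_assoc, hx]
      rintro ⟨p, hpH⟩ hp
      have := key p ((hqJ _).mp hp) 1
      rwa [one_mul] at this
  have h1 := finrank_map_add_finrank_inf_ker q H
  have h2 := LinearMap.BilinForm.finrank_add_finrank_orthogonal' (B := B) W
  rw [hB, inf_bot_eq, finrank_bot, ← Submodule.finrank_map_subtype_eq H W,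
    ← Submodule.finrank_map_subtype_eq H (B.orthogonal W), hW, Submodule.map_comap_subtype] at h2
  have h3 : gradedDim K J k = Module.finrank K (H.map q) := rfl
  omega

end Apolarity

section Graph

variable {ends : E → Sym2 V} {F H H' : Finset E} {e f : E}

/-- The endpoints of `e` lie in the same connected component of `(V, H)`. -/
def Spans (ends : E → Sym2 V) (H : Finset E) (e : E) : Prop :=
  ((ends e).map (Quot.mk (edgeRel ends H))).IsDiag

/-- The fibres of `π` are the connected components of `(V, H)`. -/
def Represents {W : Type*} (ends : E → Sym2 V) (H : Finset E) (π : V → W) : Prop :=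
  ∀ u v, π u = π v ↔ Quot.mk (edgeRel ends H) u = Quot.mk (edgeRel ends H) v

theorem exists_represents (ends : E → Sym2 V) (H : Finset E) : ∃ π : V → V, Represents ends H π :=
  ⟨fun v => (Quot.mk (edgeRel ends H) v).out, fun u v =>
    ⟨fun h => by simpa only [Quot.out_eq] using congrArg (Quot.mk (edgeRel ends H)) h,
      fun h => congrArg Quot.out h⟩⟩

theorem represents_empty : Represents ends ∅ (id : V → V) := by
  refine fun u v => ⟨fun h => congrArg _ h, fun h => ?_⟩
  induction Quot.eqvGen_exact h with
  | rel x y hxy => simp [edgeRel] at hxy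
  | refl x => rfl
  | symm x y hxy ih => exact (ih (Quot.eqvGen_sound hxy)).symm
  | trans x y z hxy hyz ih ih' =>
    exact (ih (Quot.eqvGen_sound hxy)).trans (ih' (Quot.eqvGen_sound hyz))

theorem quot_mk_eq_of_subset (hH : H ⊆ H') {u v : V}
    (h : Quot.mk (edgeRel ends H) u = Quot.mk (edgeRel ends H) v) :
    Quot.mk (edgeRel ends H') u = Quot.mk (edgeRel ends H') v :=
  Quot.eqvGen_sound ((Quot.eqvGen_exact h).mono fun _ _ ⟨x, hx, hxy⟩ => ⟨x, hH hx, hxy⟩)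

theorem Spans.mono (h : Spans ends H e) (hH : H ⊆ H') : Spans ends H' e := by
  unfold Spans at *
  induction he : ends e with
  | h a b =>
    simp only [he, Sym2.map_mk, Sym2.mk_isDiag_iff] at h ⊢
    exact quot_mk_eq_of_subset hH h

theorem spans_of_mem (he : e ∈ H) : Spans ends H e := by
  unfold Spans
  induction h : ends e with
  | h a b =>
    rw [Sym2.map_mk, Sym2.mk_isDiag_iff]
    exact Quot.sound ⟨e, he, h⟩

theorem Represents.isDiag_iff {W : Type*} {π : V → W} (hπ : Represents ends H π) :
    ((ends e).map π).IsDiag ↔ Spans ends H e := by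
  unfold Spans
  induction ends e with
  | h a b =>
    simp only [Sym2.map_mk, Sym2.mk_isDiag_iff]
    exact hπ a b

theorem Represents.numComponents_eq {W : Type*} {π : V → W} (hπ : Represents ends H π) :
    numComponents ends H = (Set.range π).ncard := by
  refine Nat.card_congr (Equiv.ofBijective (Quot.lift (fun v => (⟨π v, v, rfl⟩ : Set.range π))
    fun u v h => Subtype.ext ((hπ u v).mpr (Quot.sound h))) ⟨?_, ?_⟩)
  · rintro ⟨u⟩ ⟨v⟩ h
    exact (hπ u v).mp (congrArg Subtype.val h)
  · rintro ⟨_, v, rfl⟩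
    exact ⟨Quot.mk _ v, rfl⟩

theorem numComponents_empty : numComponents ends ∅ = Nat.card V := by
  rw [(represents_empty (ends := ends)).numComponents_eq, Set.range_id, Set.ncard_univ]

theorem isForest_empty : IsForest ends ∅ := by
  rw [IsForest, numComponents_empty, Finset.card_empty, zero_add]

theorem numComponents_le_card [Finite V] : numComponents ends H ≤ Nat.card V :=
  Nat.card_le_card_of_surjective _ Quot.mk_surjective

theorem rank_eq_rank_iff [Finite V] :
    rank ends H = rank ends H' ↔ numComponents ends H = numComponents ends H' := by
  have h1 := numComponents_le_card (ends := ends) (H := H)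
  have h2 := numComponents_le_card (ends := ends) (H := H')
  unfold rank
  omega

variable [DecidableEq E]

theorem Represents.contract_comp [DecidableEq V] {π : V → V} (hπ : Represents ends H π) {a b : V}
    (he : ends e = s(a, b)) : Represents ends (insert e H) (contract (π a) (π b) ∘ π) := by
  have hab : Quot.mk (edgeRel ends (insert e H)) a = Quot.mk (edgeRel ends (insert e H)) b :=
    Quot.sound ⟨e, Finset.mem_insert_self _ _, he⟩
  have hle : ∀ {u v}, π u = π v → Quot.mk (edgeRel ends (insert e H)) u
      = Quot.mk (edgeRel ends (insert e H)) v := fun h =>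
    quot_mk_eq_of_subset (Finset.subset_insert _ _) ((hπ _ _).mp h)
  refine fun u v => ⟨fun h => ?_, fun h => ?_⟩
  · simp only [Function.comp_apply, contract] at h
    split_ifs at h with h1 h2 h2
    · exact (hle h1).trans (hle h2).symm
    · exact (hle h1).trans (hab.symm.trans (hle h))
    · exact (hle h).trans (hab.trans (hle h2).symm)
    · exact hle h
  · induction Quot.eqvGen_exact h with
    | rel x y hxy =>
      obtain ⟨f, hf, hfe⟩ := hxy
      rcases Finset.mem_insert.mp hf with rfl | hf
      · rw [he, Sym2.eq_iff] at hfe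
        rcases hfe with ⟨rfl, rfl⟩ | ⟨rfl, rfl⟩ <;>
          simp [contract]
      · rw [Function.comp_apply, Function.comp_apply, (hπ x y).mpr (Quot.sound ⟨f, hf, hfe⟩)]
    | refl x => rfl
    | symm x y hxy ih => exact (ih (Quot.eqvGen_sound hxy)).symm
    | trans x y z hxy hyz ih ih' =>
      exact (ih (Quot.eqvGen_sound hxy)).trans (ih' (Quot.eqvGen_sound hyz))

theorem numComponents_insert_of_spans (h : Spans ends H e) :
    numComponents ends (insert e H) = numComponents ends H := by
  classical
  obtain ⟨π, hπ⟩ := exists_represents ends H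
  induction he : ends e with
  | h a b =>
    have hab : π a = π b := by
      rw [← hπ.isDiag_iff, he] at h
      exact h
    rw [(hπ.contract_comp he).numComponents_eq, hπ.numComponents_eq]
    congr 2
    ext v
    simp only [Function.comp_apply, contract, hab]
    split_ifs with hv
    · rw [hv]
    · rfl

variable [Finite V]

theorem numComponents_insert_of_not_spans (h : ¬ Spans ends H e) :
    numComponents ends (insert e H) + 1 = numComponents ends H := by
  classical
  obtain ⟨π, hπ⟩ := exists_represents ends H
  induction he : ends e with
  | h a b =>
    have hab : π a ≠ π b := by
      rw [← hπ.isDiag_iff, he] at h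
      exact h
    rw [(hπ.contract_comp he).numComponents_eq, hπ.numComponents_eq,
      ← Set.ncard_sdiff_singleton_add_one (Set.mem_range_self (f := π) b) (Set.toFinite _)]
    refine congrArg (fun s => Set.ncard s + 1) (Set.ext fun v => ?_)
    simp only [Set.mem_range, Set.mem_sdiff, Function.comp_apply, contract, Set.mem_singleton_iff]
    constructor
    · rintro ⟨u, rfl⟩
      split_ifs with hu
      · exact ⟨⟨a, rfl⟩, hab⟩
      · exact ⟨⟨u, rfl⟩, hu⟩
    · rintro ⟨⟨u, rfl⟩, hu⟩
      exact ⟨u, if_neg hu⟩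

theorem card_le_card_add_numComponents (H : Finset E) :
    Nat.card V ≤ H.card + numComponents ends H := by
  induction H using Finset.induction_on with
  | empty => rw [numComponents_empty]; exact Nat.le_add_left _ _
  | insert e H he ih =>
    rw [Finset.card_insert_of_notMem he]
    by_cases h : Spans ends H e
    · have := numComponents_insert_of_spans h
      omega
    · have := numComponents_insert_of_not_spans h
      omega

theorem isForest_insert (he : e ∉ H) :
    IsForest ends (insert e H) ↔ IsForest ends H ∧ ¬ Spans ends H e := by
  have h1 := card_le_card_add_numComponents (ends := ends) H
  unfold IsForest
  rw [Finset.card_insert_of_notMem he]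
  by_cases h : Spans ends H e
  · have := numComponents_insert_of_spans h
    simp only [h, not_true_eq_false, and_false, iff_false]
    omega
  · have := numComponents_insert_of_not_spans h
    simp only [h, not_false_eq_true, and_true]
    omega

theorem spans_iff_numComponents_eq :
    Spans ends H e ↔ numComponents ends H = numComponents ends (insert e H) := by
  refine ⟨fun h => (numComponents_insert_of_spans h).symm, fun h => ?_⟩
  by_contra h'
  have := numComponents_insert_of_not_spans h'
  omega

theorem spans_of_spans_insert (he : Spans ends H e) (hf : Spans ends (insert e H) f) :
    Spans ends H f := by
  by_contra h
  have h1 := numComponents_insert_of_spans he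
  have h2 := numComponents_insert_of_spans hf
  have h3 := numComponents_insert_of_not_spans h
  have h4 := numComponents_insert_of_spans (he.mono (Finset.subset_insert f H))
  rw [Finset.insert_comm] at h4
  omega

theorem spans_insert_exchange (he : ¬ Spans ends H e) (hf : Spans ends (insert f H) e) :
    Spans ends (insert e H) f := by
  by_contra h
  have h1 := numComponents_insert_of_not_spans he
  have h2 := numComponents_insert_of_spans hf
  have h3 := numComponents_insert_of_not_spans h
  have h4 := numComponents_insert_of_not_spans
    (mt (fun h' : Spans ends H f => h'.mono (Finset.subset_insert e H)) h)
  rw [Finset.insert_comm] at h2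
  omega

theorem extActive_iff {o : LinearOrder E} (hF : IsForest ends F) :
    ExtActive o ends F e ↔ e ∉ F ∧ Spans ends F e ∧
      ∀ f ∈ F, Spans ends (insert e (F.erase f)) f → o.le e f := by
  refine and_congr_right fun he => and_congr (by simp [isForest_insert he, hF]) ?_
  have h : ∀ f ∈ F, (rank ends ((insert e F).erase f) = rank ends (insert e F) ↔
      Spans ends (insert e (F.erase f)) f) := fun f hf => by
    have hef : e ≠ f := fun h => he (h ▸ hf)
    rw [rank_eq_rank_iff, spans_iff_numComponents_eq, Finset.erase_insert_of_ne hef,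
      Finset.insert_comm, Finset.insert_erase hf]
  refine ⟨fun H f hf hs => H f (Finset.mem_insert_of_mem hf) ((h f hf).mpr hs), fun H f hf hs => ?_⟩
  rcases Finset.mem_insert.mp hf with rfl | hf
  · exact o.le_refl _
  · exact H f hf ((h f hf).mp hs)

theorem extActive_of_spans {o : LinearOrder E} {C : Finset E}
    (he : e ∉ F) (hC : ∀ c ∈ C, o.lt e c) (hFC : IsForest ends (F ∪ C)) (h : Spans ends C e) :
    ExtActive o ends (F ∪ C) e := by
  have heC : e ∉ C := fun h => @lt_irrefl _ o.toPreorder _ (hC e h)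
  refine (extActive_iff hFC).mpr ⟨by simp [he, heC], h.mono Finset.subset_union_right,
    fun f hf hs => ?_⟩
  by_cases hfC : f ∈ C
  · exact @le_of_lt _ o.toPreorder _ _ (hC f hfC)
  have hCf : C ⊆ (F ∪ C).erase f := fun c hc =>
    Finset.mem_erase.mpr ⟨fun h => hfC (h ▸ hc), Finset.mem_union_right _ hc⟩
  rw [← Finset.insert_erase hf, isForest_insert (Finset.notMem_erase _ _)] at hFC
  exact absurd (spans_of_spans_insert (h.mono hCf) hs) hFC.2

theorem not_extActive_of_not_spans {o : LinearOrder E} {C : Finset E}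
    (he : ∀ x ∈ F, o.lt x e) (hC : ∀ c ∈ C, o.lt e c) (hFC : IsForest ends (F ∪ C))
    (h : ¬ Spans ends C e) : ¬ ExtActive o ends (F ∪ C) e := by
  rw [extActive_iff hFC]
  rintro ⟨-, h1, h2⟩
  obtain ⟨S, f, hf, hfS, hS, hS', hS''⟩ : ∃ S f, f ∈ F ∧ f ∉ S ∧ S ⊆ F ∧ ¬ Spans ends (S ∪ C) e ∧
      Spans ends (insert f (S ∪ C)) e := by
    clear h2 he hFC
    induction F using Finset.induction_on with
    | empty => exact absurd (by simpa using h1) h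
    | insert f F hf ih =>
      by_cases h3 : Spans ends (F ∪ C) e
      · obtain ⟨S, g, hg, hgS, hS, hS'⟩ := ih h3
        exact ⟨S, g, Finset.mem_insert_of_mem hg, hgS, hS.trans (Finset.subset_insert _ _), hS'⟩
      · exact ⟨F, f, Finset.mem_insert_self _ _, hf, Finset.subset_insert _ _, h3,
          by rwa [← Finset.insert_union]⟩
  have hfC : f ∉ C := fun hfC =>
    @lt_irrefl _ o.toPreorder _ (@lt_trans _ o.toPreorder _ _ _ (he f hf) (hC f hfC))
  refine @not_le_of_gt _ o.toPreorder _ _ (he f hf) (h2 f (Finset.mem_union_left _ hf)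
    ((spans_insert_exchange hS' hS'').mono (Finset.insert_subset_insert _ fun x hx => ?_)))
  refine Finset.mem_erase.mpr ⟨?_, Finset.union_subset_union_left hS hx⟩
  rintro rfl
  exact (Finset.mem_union.mp hx).elim hfS hfC

end Graph

section ForestSeries

variable [DecidableEq E]

open scoped Classical in
/-- The generating series of the `t`-labeled forests `F ⊆ A` of the graph obtained by contracting
`C`, where a label `j` contributes `t - j`. -/
noncomputable def forestSeries (o : LinearOrder E) (ends : E → Sym2 V) (t : ℕ) (A C : Finset E) :
    PowerSeries ℕ :=
  ∑ F ∈ A.powerset, if IsForest ends (F ∪ C) then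
    PowerSeries.X ^ (t * (A.filter fun x => x ∉ F ∧ ¬ ExtActive o ends (F ∪ C) x).card) *
      (∑ i ∈ Finset.range t, PowerSeries.X ^ i) ^ F.card else 0

variable {o : LinearOrder E} {ends : E → Sym2 V} {A C : Finset E} {e : E} (t : ℕ)

theorem forestSeries_empty (hC : IsForest ends C) : forestSeries o ends t ∅ C = 1 := by
  simp [forestSeries, hC]

theorem forestSeries_insert_of_spans [Finite V] (heA : e ∉ A) (hC : ∀ c ∈ C, o.lt e c)
    (h : Spans ends C e) : forestSeries o ends t (insert e A) C = forestSeries o ends t A C := by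
  classical
  have heC : e ∉ C := fun h => @lt_irrefl _ o.toPreorder _ (hC e h)
  rw [forestSeries, Finset.sum_powerset_insert heA, forestSeries, ← Finset.sum_add_distrib]
  refine Finset.sum_congr rfl fun F hF => ?_
  have heF : e ∉ F := fun h => heA (Finset.mem_powerset.mp hF h)
  have h1 : ¬ IsForest ends (insert e F ∪ C) := by
    rw [Finset.insert_union, isForest_insert (by simp [heF, heC])]
    exact fun h' => h'.2 (h.mono Finset.subset_union_right)
  rw [if_neg h1, add_zero]
  by_cases hFC : IsForest ends (F ∪ C)
  · have hact := extActive_of_spans heF hC hFC h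
    rw [if_pos hFC, if_pos hFC, Finset.filter_insert, if_neg fun h' => h'.2 hact]
  · rw [if_neg hFC, if_neg hFC]

theorem forestSeries_insert_of_not_spans [Finite V] (heA : ∀ a ∈ A, o.lt a e) (hC : ∀ c ∈ C, o.lt e c)
    (h : ¬ Spans ends C e) : forestSeries o ends t (insert e A) C =
      PowerSeries.X ^ t * forestSeries o ends t A C +
        (∑ i ∈ Finset.range t, PowerSeries.X ^ i) * forestSeries o ends t A (insert e C) := by
  classical
  have heA' : e ∉ A := fun h => @lt_irrefl _ o.toPreorder _ (heA e h)
  rw [forestSeries, Finset.sum_powerset_insert heA', forestSeries, forestSeries,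
    Finset.mul_sum, Finset.mul_sum]
  congr 1 <;> refine Finset.sum_congr rfl fun F hF => ?_
  · have heF : e ∉ F := fun h => heA' (Finset.mem_powerset.mp hF h)
    by_cases hFC : IsForest ends (F ∪ C)
    · have hact := not_extActive_of_not_spans
        (fun x hx => heA x (Finset.mem_powerset.mp hF hx)) hC hFC h
      rw [if_pos hFC, if_pos hFC, Finset.filter_insert, if_pos ⟨heF, hact⟩,
        Finset.card_insert_of_notMem (fun h => heA' (Finset.mem_filter.mp h).1)]
      ring
    · rw [if_neg hFC, if_neg hFC, mul_zero]
  · have heF : e ∉ F := fun h => heA' (Finset.mem_powerset.mp hF h)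
    have hFC : insert e F ∪ C = F ∪ insert e C := by
      rw [Finset.insert_union, Finset.union_insert]
    have hcard : (insert e A).filter (fun x => x ∉ insert e F ∧
        ¬ ExtActive o ends (F ∪ insert e C) x) =
        A.filter (fun x => x ∉ F ∧ ¬ ExtActive o ends (F ∪ insert e C) x) := by
      rw [Finset.filter_insert, if_neg (by simp)]
      refine Finset.filter_congr fun x hx => ?_
      have : x ≠ e := fun h => heA' (h ▸ hx)
      simp [this]
    rw [hFC, hcard, Finset.card_insert_of_notMem heF, mul_ite, mul_zero]
    refine if_congr Iff.rfl ?_ rfl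
    ring

theorem card_add_act_add_card [Fintype E] (o : LinearOrder E) (ends : E → Sym2 V) (F : Finset E)
    [DecidablePred fun x => x ∉ F ∧ ¬ ExtActive o ends F x] :
    F.card + act o ends F + (Finset.univ.filter fun x => x ∉ F ∧ ¬ ExtActive o ends F x).card
      = Fintype.card E := by
  classical
  have h1 : act o ends F = (Finset.univ.filter fun x => ExtActive o ends F x).card := by
    rw [act, ← Set.ncard_coe_finset]
    simp
  rw [h1, ← Finset.card_union_of_disjoint, ← Finset.card_union_of_disjoint, ← Finset.card_univ]
  · congr 1
    ext x
    simp only [Finset.mem_union, Finset.mem_filter, Finset.mem_univ, true_and, iff_true]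
    tauto
  · refine Finset.disjoint_left.mpr fun x hx hx' => ?_
    simp only [Finset.mem_union, Finset.mem_filter, Finset.mem_univ, true_and] at hx hx'
    tauto
  · exact Finset.disjoint_left.mpr fun x hx hx' => (Finset.mem_filter.mp hx').2.1 hx

/-- The set of functions labeling `F` by `{1, …, t}` and vanishing off `F`. -/
def labelings [Fintype E] (t : ℕ) (F : Finset E) : Finset (E → ℕ) :=
  Fintype.piFinset fun e => if e ∈ F then Finset.Icc 1 t else {0}

theorem mem_labelings [Fintype E] {F : Finset E} {l : E → ℕ} :
    l ∈ labelings t F ↔ (∀ e ∈ F, 1 ≤ l e ∧ l e ≤ t) ∧ ∀ e ∉ F, l e = 0 := by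
  rw [labelings, Fintype.mem_piFinset]
  constructor
  · refine fun h => ⟨fun e he => ?_, fun e he => ?_⟩ <;> simpa [he] using h e
  · rintro ⟨h, h'⟩ e
    by_cases he : e ∈ F
    · simpa [he] using h e he
    · simpa [he] using h' e he

theorem sum_X_pow_pow_card [Fintype E] (t : ℕ) (F : Finset E) :
    (∑ i ∈ Finset.range t, PowerSeries.X ^ i : PowerSeries ℕ) ^ F.card
      = ∑ l ∈ labelings t F, PowerSeries.X ^ ∑ e ∈ F, (t - l e) := by
  have h : (∑ i ∈ Finset.range t, PowerSeries.X ^ i : PowerSeries ℕ)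
      = ∑ j ∈ Finset.Icc 1 t, PowerSeries.X ^ (t - j) := by
    refine Finset.sum_nbij' (fun i => t - i) (fun j => t - j) ?_ ?_ ?_ ?_ ?_ <;> intro i hi <;>
      simp only [Finset.mem_range, Finset.mem_Icc] at hi ⊢
    · omega
    · omega
    · omega
    · omega
    · congr 1
      omega
  have h2 : ∀ e : E, (if e ∈ F then ∑ j ∈ Finset.Icc 1 t, PowerSeries.X ^ (t - j)
        else 1 : PowerSeries ℕ) = ∑ j ∈ if e ∈ F then Finset.Icc 1 t else {0},
          if e ∈ F then PowerSeries.X ^ (t - j) else 1 := fun e => by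
    split_ifs <;> simp
  rw [h, ← Finset.prod_const, ← Finset.univ_inter F, ← Finset.prod_ite_mem,
    Finset.prod_congr rfl fun e _ => h2 e, Finset.prod_univ_sum, Finset.univ_inter]
  refine Finset.sum_congr rfl fun l _ => ?_
  rw [Finset.prod_ite_mem, Finset.univ_inter, Finset.prod_pow_eq_pow_sum]

theorem coeff_forestSeries [Fintype E] (o : LinearOrder E) (ends : E → Sym2 V) (k : ℕ) :
    PowerSeries.coeff k (forestSeries o ends t Finset.univ ∅) =
      Nat.card {F : LabeledForest ends t //
        weight F + t * act o ends F.edges + k = t * Fintype.card E} := by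
  classical
  let m : Finset E → ℕ := fun F =>
    (Finset.univ.filter fun x => x ∉ F ∧ ¬ ExtActive o ends F x).card
  have hiff : ∀ F, ∀ l ∈ labelings t F, (k = t * m F + ∑ e ∈ F, (t - l e) ↔
      ∑ e ∈ F, l e + t * act o ends F + k = t * Fintype.card E) := fun F l hl => by
    have h1 : ∑ e ∈ F, (t - l e) + ∑ e ∈ F, l e = t * F.card := by
      rw [← Finset.sum_add_distrib, Finset.sum_congr rfl fun e he =>
        Nat.sub_add_cancel (((mem_labelings t).mp hl).1 e he).2, Finset.sum_const, smul_eq_mul,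
        mul_comm]
    rw [← card_add_act_add_card o ends F, mul_add, mul_add, ← h1]
    change k = t * m F + _ ↔ _ = _ + t * m F
    omega
  let S : Finset (Σ _ : Finset E, E → ℕ) := Finset.univ.sigma fun F =>
    (labelings t F).filter fun l => IsForest ends F ∧ k = t * m F + ∑ e ∈ F, (t - l e)
  have hS : PowerSeries.coeff k (forestSeries o ends t Finset.univ ∅) = S.card := by
    simp only [forestSeries, map_sum, S, Finset.card_sigma, Finset.powerset_univ]
    refine Finset.sum_congr rfl fun F _ => ?_
    simp only [Finset.union_empty]
    by_cases hF : IsForest ends F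
    · rw [if_pos hF, sum_X_pow_pow_card, Finset.mul_sum, map_sum,
        Finset.card_filter _ (labelings t F)]
      refine Finset.sum_congr rfl fun l _ => ?_
      rw [← pow_add, PowerSeries.coeff_X_pow]
      simp [hF, m]
    · simp [hF]
  have hmem : ∀ F l, ⟨F, l⟩ ∈ S ↔ l ∈ labelings t F ∧ IsForest ends F ∧
      k = t * m F + ∑ e ∈ F, (t - l e) := fun F l => by
    simp only [S, Finset.mem_sigma, Finset.mem_univ, true_and, Finset.mem_filter]
  rw [hS, ← Nat.card_eq_finsetCard]
  refine Nat.card_congr ⟨fun x => ⟨⟨(x.1.1, x.1.2), ?_⟩, ?_⟩, fun F => ⟨⟨F.1.1.1, F.1.1.2⟩, ?_⟩,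
    fun _ => rfl, fun _ => rfl⟩
  · have h := (hmem _ _).mp x.2
    exact ⟨h.2.1, (mem_labelings t).mp h.1⟩
  · have h := (hmem _ _).mp x.2
    exact (hiff _ _ h.1).mp h.2.2
  · have h := (mem_labelings t).mpr F.1.2.2
    exact (hmem _ _).mpr ⟨h, F.1.2.1, (hiff _ _ h).mpr F.2⟩

end ForestSeries

section Comparison

theorem hilb_eq_forestSeries (K : Type*) [Field K] [CharZero K] [Fintype V] [DecidableEq V]
    [DecidableEq E] (o : LinearOrder E) (ends : E → Sym2 V) (t : ℕ) (A : Finset E) :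
    ∀ (C : Finset E) (π : V → V), IsForest ends C → Represents ends C π →
      (∀ a ∈ A, ∀ c ∈ C, o.lt a c) →
      hilb K (∑ e ∈ A, Multiset.replicate t ((ends e).map π)) = forestSeries o ends t A C := by
  induction A using @Finset.induction_on_max E o _ with
  | empty =>
    intro C π hC _ _
    rw [Finset.sum_empty, hilb_zero, forestSeries_empty t hC]
  | insert e A heA ih =>
    intro C π hC hπ hlt
    have heA' : e ∉ A := fun h => @lt_irrefl _ o.toPreorder _ (heA e h)
    have hA : ∀ a ∈ A, ∀ c ∈ C, o.lt a c := fun a ha =>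
      hlt a (Finset.mem_insert_of_mem ha)
    have heC : ∀ c ∈ C, o.lt e c := hlt e (Finset.mem_insert_self _ _)
    rw [Finset.sum_insert heA']
    by_cases h : Spans ends C e
    · rw [forestSeries_insert_of_spans t heA' heC h, ← ih C π hC hπ hA]
      rw [← hπ.isDiag_iff] at h
      induction he : ends e with
      | h a b =>
        rw [he, Sym2.map_mk, Sym2.mk_isDiag_iff] at h
        rw [Sym2.map_mk, h, hilb_replicate_diag_add]
    · have heC' : e ∉ C := fun h' => h (spans_of_mem h')
      have hlt' : ∀ a ∈ A, ∀ c ∈ insert e C, o.lt a c := fun a ha c hc => by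
        rcases Finset.mem_insert.mp hc with rfl | hc
        · exact heA a ha
        · exact hA a ha c hc
      have hfor := (isForest_insert heC').mpr ⟨hC, h⟩
      rw [forestSeries_insert_of_not_spans t heA heC h, ← ih C π hC hπ hA]
      rw [← hπ.isDiag_iff] at h
      induction he : ends e with
      | h a b =>
        rw [he, Sym2.map_mk, Sym2.mk_isDiag_iff] at h
        rw [← ih _ _ hfor (hπ.contract_comp he) hlt', Sym2.map_mk, hilb_replicate_add h,
          ← Multiset.coe_mapAddMonoidHom, map_sum]
        simp only [Multiset.coe_mapAddMonoidHom, Multiset.map_replicate, Sym2.map_map]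

theorem cutSize_sum_replicate [Fintype E] {n : ℕ} (ends : E → Sym2 (Fin n)) (t : ℕ)
    (I : Finset (Fin n)) :
    cutSize (∑ e, Multiset.replicate t (ends e)) I = t * crossCount ends I := by
  classical
  have h : crossCount ends I = (Finset.univ.filter fun e => Crosses I (ends e)).card := by
    rw [crossCount, ← Set.ncard_coe_finset]
    refine congrArg Set.ncard (Set.ext fun e => ?_)
    rw [Finset.mem_coe, Finset.mem_filter, and_iff_right (Finset.mem_univ e)]
    rfl
  rw [cutSize, ← Multiset.coe_countPAddMonoidHom, map_sum, h, Finset.card_filter, Finset.mul_sum]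
  refine Finset.sum_congr rfl fun e _ => ?_
  rw [Multiset.coe_countPAddMonoidHom, ← Multiset.nsmul_singleton, Multiset.countP_nsmul,
    ← Multiset.cons_zero, Multiset.countP_cons, Multiset.countP_zero, zero_add]

end Comparison

/-- For a finite multigraph `G` with a linear order `o` on its
edges, an integer `t ≥ 1` and a field `K` of characteristic `0`, the dimension
of the `k`-th graded component of `B_G^{F_t}` equals the number of `t`-labeled
forests `F` with weight `ω(F) = t·(e(G) - act_G(F)) - k` (stated as
`ω(F) + t·act_G(F) + k = t·e(G)`). -/
theorem gradedDim_B_Ft_eq_card_labeledForests {n : ℕ} {E : Type} [Fintype E]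
    [DecidableEq E] (o : LinearOrder E) (ends : E → Sym2 (Fin n))
    (t : ℕ) (ht : 1 ≤ t) (K : Type) [Field K] [CharZero K] (k : ℕ) :
    gradedDim K (forestIdeal K t ends) k
      = Nat.card {F : LabeledForest ends t //
          weight F + t * act o ends F.edges + k = t * Fintype.card E} := by
  have hJ : forestIdeal K t ends = Ideal.span {p | ∃ I : Finset (Fin n), I.Nonempty ∧
      p = (∑ i ∈ I, X i) ^ (cutSize (∑ e, Multiset.replicate t (ends e)) I + 1)} := by
    simp only [forestIdeal, cutSize_sum_replicate]
  have h := hilb_eq_forestSeries K o ends t Finset.univ ∅ id isForest_empty represents_empty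
    (by simp)
  simp only [Sym2.map_id', id_eq] at h
  rw [finrank_gradedPiece_eq hJ, ← coeff_forestSeries, ← h, hilb, PowerSeries.coeff_mk]

end ForestAlg
end

section
/- Let G be a finite multigraph, t ≥ 1 an integer, and K a field of characteristic 0. The algebras C_G^{F_t} and C_Ĝ^{F_1} are isomorphic as K-algebras; an isomorphism is induced by the map of ambient algebras Φ_Ĝ^{F_1} → Φ_G^{F_t} determined by sending, for each edge e of G, the sum φ_{e_1}+…+φ_{e_t} of the variables of its t clones to φ_e (which is well defined because (φ_{e_1}+…+φ_{e_t})^{t+1} = 0 in Φ_Ĝ^{F_1}). -/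
open MvPolynomial

namespace ForestAlg

variable {V E : Type*}

/-- The ideal `(φ_e^{t+1} : e ∈ E)` in `K[φ_e : e ∈ E]`. -/
noncomputable def phiIdeal (K : Type*) [Field K] (E : Type*) (t : ℕ) :
    Ideal (MvPolynomial E K) :=
  Ideal.span (Set.range fun e : E => (X e : MvPolynomial E K) ^ (t + 1))

/-- The algebra `Φ_G^{F_t}` generated by commuting variables `φ_e` with relations
`φ_e^{t+1} = 0`. -/
abbrev Phi (K : Type*) [Field K] (E : Type*) (t : ℕ) : Type _ :=
  MvPolynomial E K ⧸ phiIdeal K E t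

/-- The generator `φ_e` of `Φ_G^{F_t}`. -/
noncomputable def phiVar (K : Type*) [Field K] {E : Type*} (t : ℕ) (e : E) :
    Phi K E t :=
  Ideal.Quotient.mk (phiIdeal K E t) (X e)

/-- The smaller endpoint of an edge. -/
def symInf {n : ℕ} (s : Sym2 (Fin n)) : Fin n :=
  Sym2.lift ⟨fun a b => a ⊓ b, fun a b => inf_comm a b⟩ s

/-- The larger endpoint of an edge. -/
def symSup {n : ℕ} (s : Sym2 (Fin n)) : Fin n :=
  Sym2.lift ⟨fun a b => a ⊔ b, fun a b => sup_comm a b⟩ s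

/-- The coefficient `c_{i,e}`: `+1` if `i` is the smaller endpoint of the
non-loop edge `e`, `-1` if `i` is the larger endpoint, `0` otherwise. -/
def endCoeff {n : ℕ} (ends : E → Sym2 (Fin n)) (i : Fin n) (e : E) : ℤ :=
  (if i = symInf (ends e) then 1 else 0) - (if i = symSup (ends e) then 1 else 0)

/-- The element `X_i = ∑_e c_{i,e} φ_e` of `Φ_G^{F_t}`. -/
noncomputable def Xgen (K : Type*) [Field K] [Fintype E] {n : ℕ} (t : ℕ)
    (ends : E → Sym2 (Fin n)) (i : Fin n) : Phi K E t :=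
  ∑ e : E, endCoeff ends i e • phiVar K t e

/-- The subalgebra `C_G^{F_t}` of `Φ_G^{F_t}` generated by `X_1, …, X_n`. -/
noncomputable def Csub (K : Type*) [Field K] [Fintype E] {n : ℕ} (t : ℕ)
    (ends : E → Sym2 (Fin n)) : Subalgebra K (Phi K E t) :=
  Algebra.adjoin K (Set.range (Xgen K t ends))


/-- A sum of `s.card` commuting elements of square zero has vanishing `(s.card + 1)`-st power. -/
theorem sum_pow_card_succ_eq_zero {R ι : Type*} [CommRing R] (x : ι → R)
    (hx : ∀ i, x i ^ 2 = 0) (s : Finset ι) : (∑ i ∈ s, x i) ^ (s.card + 1) = 0 := by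
  classical
  induction s using Finset.induction_on with
  | empty => simp
  | insert a s ha ih =>
    rw [Finset.sum_insert ha, Finset.card_insert_of_notMem ha]
    exact (Commute.all _ _).add_pow_eq_zero_of_add_le_succ_of_pow_eq_zero (hx a) ih (by omega)

theorem phiVar_pow_succ (K : Type*) [Field K] {E : Type*} (t : ℕ) (e : E) :
    phiVar K t e ^ (t + 1) = 0 := by
  rw [phiVar, ← map_pow]
  exact Ideal.Quotient.eq_zero_iff_mem.2 (Ideal.subset_span ⟨e, rfl⟩)

theorem sum_clones_pow_succ (K : Type*) [Field K] {E : Type*} (t : ℕ) (e : E) :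
    (∑ i : Fin t, phiVar K 1 (e, i)) ^ (t + 1) = (0 : Phi K (E × Fin t) 1) := by
  simpa using sum_pow_card_succ_eq_zero (fun i : Fin t => phiVar K 1 (e, i))
    (fun i => phiVar_pow_succ K 1 (e, i)) Finset.univ

/-- The algebra map `Φ_G^{F_t} → Φ_Ĝ^{F_1}` sending `φ_e` to the sum of its clones. -/
noncomputable def cloneMap (K : Type*) [Field K] (E : Type*) (t : ℕ) :
    Phi K E t →ₐ[K] Phi K (E × Fin t) 1 :=
  Ideal.Quotient.liftₐ (phiIdeal K E t)
    (aeval fun e : E => ∑ i : Fin t, phiVar K 1 (e, i)) (by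
      have h : phiIdeal K E t ≤ RingHom.ker
          (aeval fun e : E => ∑ i : Fin t, phiVar K 1 (e, i) :
            MvPolynomial E K →ₐ[K] Phi K (E × Fin t) 1) := by
        rw [phiIdeal, Ideal.span_le]
        rintro _ ⟨e, rfl⟩
        simp only [SetLike.mem_coe, RingHom.mem_ker, map_pow, aeval_X]
        exact sum_clones_pow_succ K t e
      exact fun a ha => RingHom.mem_ker.1 (h ha))

theorem cloneMap_phiVar (K : Type*) [Field K] {E : Type*} (t : ℕ) (e : E) :
    cloneMap K E t (phiVar K t e) = ∑ i : Fin t, phiVar K 1 (e, i) := by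
  exact aeval_X _ _

/-- The total exponent of the clones of `e` in a monomial. -/
def cloneDegree {t : ℕ} (s : E × Fin t →₀ ℕ) (e : E) : ℕ :=
  ∑ i : Fin t, s (e, i)

theorem cloneDegree_add_single [DecidableEq E] {t : ℕ} (s : E × Fin t →₀ ℕ) (e e' : E)
    (i : Fin t) :
    cloneDegree (s + Finsupp.single (e, i) 1) e' =
      cloneDegree s e' + if e' = e then 1 else 0 := by
  classical
  simp only [cloneDegree, Finsupp.add_apply, Finset.sum_add_distrib, Finsupp.single_apply,
    Prod.mk.injEq]
  by_cases h : e = e'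
  · subst h; simp
  · simp [h, Ne.symm h]

section Collapse

variable (K : Type*) [Field K] [Fintype E] (t : ℕ)

open Classical in
/-- The image of a monomial under `collapse`. -/
noncomputable def collapseMonomial (s : E × Fin t →₀ ℕ) : Phi K E t :=
  if ∀ p, s p ≤ 1 then
    ∏ e : E, ((t - cloneDegree s e).factorial : Phi K E t) * phiVar K t e ^ cloneDegree s e
  else 0

/-- The linear map identifying all clones of each edge, with weights making it linear over
`K[φ_e : e ∈ E]`. -/
noncomputable def collapse : MvPolynomial (E × Fin t) K →ₗ[K] Phi K E t :=
  (basisMonomials (E × Fin t) K).constr K (collapseMonomial K t)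

variable {t}

theorem collapse_monomial (s : E × Fin t →₀ ℕ) (a : K) :
    collapse K t (monomial s a) = a • collapseMonomial K t s := by
  have h : (monomial s a : MvPolynomial (E × Fin t) K) = a • basisMonomials (E × Fin t) K s := by
    simp [smul_monomial]
  rw [h, map_smul, collapse, Module.Basis.constr_basis]

theorem sum_collapseMonomial (s : E × Fin t →₀ ℕ) (e : E) :
    ∑ i : Fin t, collapseMonomial K t (s + Finsupp.single (e, i) 1) =
      phiVar K t e * collapseMonomial K t s := by
  classical
  by_cases hs : ∀ p, s p ≤ 1
  swap
  · have h (i : Fin t) : ¬ ∀ p, (s + Finsupp.single (e, i) 1 : E × Fin t →₀ ℕ) p ≤ 1 := fun h =>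
      hs fun p => le_trans (by simp) (h p)
    simp only [collapseMonomial, if_neg hs, if_neg (h _), Finset.sum_const_zero, mul_zero]
  set P : Phi K E t := ∏ e' ∈ Finset.univ.erase e,
    ((t - cloneDegree s e').factorial : Phi K E t) * phiVar K t e' ^ cloneDegree s e' with hP
  have hterm (i : Fin t) : collapseMonomial K t (s + Finsupp.single (e, i) 1) =
      if s (e, i) = 0 then ((t - (cloneDegree s e + 1)).factorial : Phi K E t) *
        phiVar K t e ^ (cloneDegree s e + 1) * P else 0 := by
    have hiff : (∀ p, (s + Finsupp.single (e, i) 1 : E × Fin t →₀ ℕ) p ≤ 1) ↔ s (e, i) = 0 := by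
      constructor
      · intro h
        simpa using h (e, i)
      · intro h p
        by_cases hp : (e, i) = p
        · subst hp; simp [h]
        · simpa [Finsupp.single_apply, hp] using hs p
    simp only [collapseMonomial, hiff]
    refine if_congr Iff.rfl ?_ rfl
    rw [← Finset.mul_prod_erase _ _ (Finset.mem_univ e), cloneDegree_add_single, if_pos rfl, hP]
    congr 1
    refine Finset.prod_congr rfl fun e' he' => ?_
    rw [cloneDegree_add_single, if_neg (Finset.ne_of_mem_erase he'), add_zero]
  have hcard : (Finset.univ.filter fun i : Fin t => s (e, i) = 0).card + cloneDegree s e = t := by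
    rw [Finset.card_filter, cloneDegree, ← Finset.sum_add_distrib,
      Finset.sum_congr rfl (g := fun _ => 1), Finset.sum_const, Finset.card_univ, Fintype.card_fin,
      smul_eq_mul, mul_one]
    intro i _
    have := hs (e, i)
    split_ifs <;> omega
  have hs' : collapseMonomial K t s = ((t - cloneDegree s e).factorial : Phi K E t) *
      phiVar K t e ^ cloneDegree s e * P := by
    rw [collapseMonomial, if_pos hs, ← Finset.mul_prod_erase _ _ (Finset.mem_univ e)]
  simp only [hterm]
  rw [← Finset.sum_filter, Finset.sum_const, hs', nsmul_eq_mul]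
  set k := cloneDegree s e
  rcases (show k ≤ t by omega).eq_or_lt with hk | hk
  · have h0 := phiVar_pow_succ K t e
    have hc : (Finset.univ.filter fun i : Fin t => s (e, i) = 0).card = 0 := by omega
    rw [hc, hk]
    linear_combination (-((t - t).factorial : Phi K E t) * P) * h0
  · obtain ⟨m, hm⟩ : ∃ m, t = k + 1 + m := ⟨t - (k + 1), by omega⟩
    have hc : (Finset.univ.filter fun i : Fin t => s (e, i) = 0).card = m + 1 := by omega
    have h1 : t - (k + 1) = m := by omega
    have h2 : t - k = m + 1 := by omega
    rw [hc, h1, h2, Nat.factorial_succ]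
    push_cast
    ring

theorem collapse_sum_clones_mul (e : E) (g : MvPolynomial (E × Fin t) K) :
    collapse K t ((∑ i : Fin t, X (e, i)) * g) = phiVar K t e * collapse K t g := by
  induction g using MvPolynomial.induction_on' with
  | monomial s a =>
    have h (i : Fin t) : X (e, i) * monomial s a =
        (monomial (s + Finsupp.single (e, i) 1) a : MvPolynomial (E × Fin t) K) := by
      rw [X, monomial_mul, one_mul, add_comm]
    rw [Finset.sum_mul, map_sum]
    simp only [h, collapse_monomial]
    rw [← Finset.smul_sum, sum_collapseMonomial, mul_smul_comm]
  | add p q hp hq => rw [mul_add, map_add, hp, hq, map_add, mul_add]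

theorem collapse_mul_X_sq (p : E × Fin t) (g : MvPolynomial (E × Fin t) K) :
    collapse K t (g * X p ^ 2) = 0 := by
  induction g using MvPolynomial.induction_on' with
  | monomial s a =>
    have h : ¬ ∀ q, (s + Finsupp.single p 2 : E × Fin t →₀ ℕ) q ≤ 1 := fun h => by
      have := h p
      simp at this
    rw [X_pow_eq_monomial, monomial_mul, collapse_monomial, collapseMonomial, if_neg h, smul_zero]
  | add p q hp hq => rw [add_mul, map_add, hp, hq, add_zero]

theorem collapse_eq_zero_of_mem {q : MvPolynomial (E × Fin t) K}
    (hq : q ∈ phiIdeal K (E × Fin t) 1) : collapse K t q = 0 := by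
  suffices h : ∀ g, collapse K t (g * q) = 0 by simpa using h 1
  induction hq using Submodule.span_induction with
  | mem x hx =>
    obtain ⟨p, rfl⟩ := hx
    exact collapse_mul_X_sq K p
  | zero => simp
  | add x y _ _ hx hy => intro g; rw [mul_add, map_add, hx, hy, add_zero]
  | smul a x _ hx => intro g; rw [smul_eq_mul, ← mul_assoc]; exact hx _

theorem collapse_one :
    collapse K t (1 : MvPolynomial (E × Fin t) K) =
      (t.factorial : Phi K E t) ^ Fintype.card E := by
  rw [← C_1, ← monomial_zero', collapse_monomial, collapseMonomial, if_pos (by simp)]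
  simp [cloneDegree]

theorem collapse_aeval_sum_clones (p : MvPolynomial E K) :
    collapse K t (aeval (fun e : E => ∑ i : Fin t, X (e, i)) p) =
      (t.factorial : Phi K E t) ^ Fintype.card E * Ideal.Quotient.mk (phiIdeal K E t) p := by
  induction p using MvPolynomial.induction_on with
  | C a =>
    rw [aeval_C, Algebra.algebraMap_eq_smul_one, map_smul, collapse_one, ← mul_one (C a),
      ← smul_eq_C_mul, ← Ideal.Quotient.mkₐ_eq_mk K, map_smul, map_one, mul_smul_comm, mul_one]
  | add p q hp hq => rw [map_add, map_add, hp, hq, map_add, mul_add]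
  | mul_X p e hp =>
    rw [map_mul, aeval_X, mul_comm, collapse_sum_clones_mul, hp, map_mul, phiVar]
    ring

theorem cloneMap_injective [CharZero K] : Function.Injective (cloneMap K E t) := by
  rw [injective_iff_map_eq_zero]
  intro a ha
  obtain ⟨p, rfl⟩ := Ideal.Quotient.mk_surjective a
  have hcomp : (Ideal.Quotient.mkₐ K (phiIdeal K (E × Fin t) 1)).comp
      (aeval fun e : E => ∑ i : Fin t, X (e, i)) =
      (cloneMap K E t).comp (Ideal.Quotient.mkₐ K (phiIdeal K E t)) := by
    ext e
    have h := cloneMap_phiVar K t e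
    simp only [phiVar] at h
    simp [h]
  have hmem : aeval (fun e : E => ∑ i : Fin t, X (e, i)) p ∈ phiIdeal K (E × Fin t) 1 :=
    Ideal.Quotient.eq_zero_iff_mem.1 ((DFunLike.congr_fun hcomp p).trans ha)
  have h := collapse_eq_zero_of_mem K hmem
  rw [collapse_aeval_sum_clones] at h
  have hu : IsUnit ((t.factorial : Phi K E t) ^ Fintype.card E) := by
    have : IsUnit (t.factorial : K) :=
      (Nat.cast_ne_zero.2 t.factorial_ne_zero).isUnit
    simpa using (this.map (algebraMap K (Phi K E t))).pow (Fintype.card E)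
  exact hu.mul_right_eq_zero.1 h

theorem cloneMap_Xgen {n : ℕ} (ends : E → Sym2 (Fin n)) (i : Fin n) :
    cloneMap K E t (Xgen K t ends i) =
      Xgen K 1 (fun p : E × Fin t => ends p.1) i := by
  simp only [Xgen, map_sum, map_zsmul, cloneMap_phiVar, Fintype.sum_prod_type, Finset.smul_sum]
  rfl

theorem map_cloneMap_Csub {n : ℕ} (ends : E → Sym2 (Fin n)) :
    (Csub K t ends).map (cloneMap K E t) = Csub K 1 (fun p : E × Fin t => ends p.1) := by
  rw [Csub, AlgHom.map_adjoin, ← Set.range_comp, Csub]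
  congr 2
  exact funext (cloneMap_Xgen K ends)

end Collapse

/-- Let `G` be a finite multigraph on vertices `1,…,n`,
`t ≥ 1`, and `K` a field of characteristic `0`. Let `Ĝ` (edge set `E × Fin t`)
be obtained from `G` by replacing each edge by `t` parallel clones. Then
`(φ_{e_1} + … + φ_{e_t})^{t+1} = 0` in `Φ_Ĝ^{F_1}`, and there is a
well-defined `K`-algebra map `ψ : Φ_G^{F_t} → Φ_Ĝ^{F_1}` identifying `φ_e` with
`φ_{e_1} + … + φ_{e_t}`; `ψ` is injective on `C_G^{F_t}` and maps it onto
`C_Ĝ^{F_1}`, inducing an isomorphism `C_G^{F_t} ≃ C_Ĝ^{F_1}` of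
`K`-algebras. -/
theorem C_Ft_iso_C_hat_F1 {n : ℕ} {E : Type} [Fintype E]
    (ends : E → Sym2 (Fin n)) (t : ℕ) (ht : 1 ≤ t)
    (K : Type) [Field K] [CharZero K] :
    letI hatEnds : E × Fin t → Sym2 (Fin n) := fun p => ends p.1
    (∀ e : E, (∑ i : Fin t, phiVar K 1 (e, i)) ^ (t + 1)
        = (0 : Phi K (E × Fin t) 1)) ∧
    (∃ ψ : Phi K E t →ₐ[K] Phi K (E × Fin t) 1,
      (∀ e : E, ψ (phiVar K t e) = ∑ i : Fin t, phiVar K 1 (e, i)) ∧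
      Set.InjOn ψ (Csub K t ends) ∧
      ψ '' (Csub K t ends) = (Csub K 1 hatEnds : Set (Phi K (E × Fin t) 1))) ∧
    Nonempty ((Csub K t ends) ≃ₐ[K] (Csub K 1 hatEnds)) := by
  refine ⟨sum_clones_pow_succ K t, ⟨cloneMap K E t, cloneMap_phiVar K t,
    (cloneMap_injective K).injOn, ?_⟩, ⟨?_⟩⟩
  · rw [← map_cloneMap_Csub, Subalgebra.coe_map]
  · exact ((Csub K t ends).equivMapOfInjective _ (cloneMap_injective K)).trans
      (Subalgebra.equivOfEq _ _ (map_cloneMap_Csub K ends))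

end ForestAlg
end

section
/- Let G be a finite multigraph, t ≥ 1 an integer, and e a bridge of G. Then T_Ĝ(x,y) = (y^{t−1} + y^{t−2} + … + y + 1) · T_{\widehat{G·e}}(x,y) + (x−1) · T_{\widehat{G−e}}(x,y), where for a multigraph H, Ĥ denotes the multigraph obtained from H by replacing every edge by t parallel copies. -/
open MvPolynomial

namespace ForestAlg

variable {V E : Type*}

section Quotients

variable {U : Type*}

/-- Relations that identify the same points have equivalent quotients. -/
def quotEquivOfSound {r s : U → U → Prop}
    (hrs : ∀ u v, r u v → Quot.mk s u = Quot.mk s v)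
    (hsr : ∀ u v, s u v → Quot.mk r u = Quot.mk r v) : Quot r ≃ Quot s where
  toFun := Quot.lift (Quot.mk s) hrs
  invFun := Quot.lift (Quot.mk r) hsr
  left_inv := by rintro ⟨u⟩; rfl
  right_inv := by rintro ⟨u⟩; rfl

/-- Taking the quotient by `s` and then by the image of `r` is taking the quotient by both. -/
def quotQuotEquiv (r s : U → U → Prop) :
    Quot (Relation.Map r (Quot.mk s) (Quot.mk s)) ≃ Quot (fun u v => r u v ∨ s u v) where
  toFun := Quot.lift
    (Quot.lift (Quot.mk _) fun _ _ h => Quot.sound (Or.inr h))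
    (by rintro _ _ ⟨u, v, h, rfl, rfl⟩; exact Quot.sound (Or.inl h))
  invFun := Quot.lift (fun u => Quot.mk _ (Quot.mk s u)) (by
    rintro u v (h | h)
    · exact Quot.sound ⟨u, v, h, rfl, rfl⟩
    · exact congrArg _ (Quot.sound h))
  left_inv := by rintro ⟨⟨u⟩⟩; rfl
  right_inv := by rintro ⟨u⟩; rfl

/-- Identifying two distinct points amounts to removing one of them. -/
def quotPairEquiv [DecidableEq U] {a b : U} (hab : a ≠ b) :
    Quot (fun u v : U => u = a ∧ v = b) ≃ {u : U // u ≠ b} where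
  toFun := Quot.lift (fun u => if h : u = b then ⟨a, hab⟩ else ⟨u, h⟩) (by
    rintro u v ⟨rfl, rfl⟩; simp [hab])
  invFun u := Quot.mk _ u.1
  left_inv := by
    rintro ⟨u⟩
    by_cases h : u = b
    · simpa [h] using Quot.sound (r := fun u v : U => u = a ∧ v = b) ⟨rfl, rfl⟩
    · simp [h]
  right_inv := by rintro ⟨u, h⟩; simp [h]

theorem card_quot_pair_add_one [Finite U] {a b : U} (hab : a ≠ b) :
    Nat.card (Quot fun u v : U => u = a ∧ v = b) + 1 = Nat.card U := by
  classical
  have := Fintype.ofFinite U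
  have hpos : 0 < Fintype.card U := Fintype.card_pos_iff.2 ⟨a⟩
  rw [Nat.card_congr (quotPairEquiv hab), Nat.card_eq_fintype_card, Nat.card_eq_fintype_card,
    Fintype.card_subtype_compl, Fintype.card_subtype_eq]
  omega

theorem card_le_card_quot_pair_add_one [Finite U] (a b : U) :
    Nat.card U ≤ Nat.card (Quot fun u v : U => u = a ∧ v = b) + 1 := by
  by_cases hab : a = b
  · have e : Quot (fun u v : U => u = a ∧ v = b) ≃ Quot (fun _ _ : U => False) :=
      quotEquivOfSound (by rintro u v ⟨rfl, rfl⟩; rw [hab]) (by simp)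
    have e' : Quot (fun _ _ : U => False) ≃ U :=
      ⟨Quot.lift id (by simp), Quot.mk _, by rintro ⟨u⟩; rfl, fun u => rfl⟩
    rw [Nat.card_congr (e.trans e')]
    omega
  · exact (card_quot_pair_add_one hab).ge

theorem map_pair (r : U → U → Prop) (a b : U) :
    Relation.Map (fun u v => u = a ∧ v = b) (Quot.mk r) (Quot.mk r)
      = fun p q => p = Quot.mk r a ∧ q = Quot.mk r b := by
  funext p q
  refine propext ⟨?_, ?_⟩
  · rintro ⟨_, _, ⟨rfl, rfl⟩, rfl, rfl⟩; exact ⟨rfl, rfl⟩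
  · rintro ⟨rfl, rfl⟩; exact ⟨a, b, ⟨rfl, rfl⟩, rfl, rfl⟩

end Quotients

section Components

variable {U F : Type*}

theorem mk_edgeRel_mono {ends : F → Sym2 U} {A B : Finset F} (h : A ⊆ B) {u v : U}
    (huv : Quot.mk (edgeRel ends A) u = Quot.mk (edgeRel ends A) v) :
    Quot.mk (edgeRel ends B) u = Quot.mk (edgeRel ends B) v :=
  have hrel : ∀ u v, edgeRel ends A u v → edgeRel ends B u v :=
    fun _ _ ⟨f, hf, hfe⟩ => ⟨f, h hf, hfe⟩
  congrArg (Quot.map id hrel) huv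

theorem numComponents_anti [Finite U] (ends : F → Sym2 U) {A B : Finset F} (h : A ⊆ B) :
    numComponents ends B ≤ numComponents ends A := by
  have hrel : ∀ u v, edgeRel ends A u v → edgeRel ends B u v :=
    fun _ _ ⟨f, hf, hfe⟩ => ⟨f, h hf, hfe⟩
  refine Nat.card_le_card_of_surjective (Quot.map id hrel) ?_
  rintro ⟨u⟩
  exact ⟨Quot.mk _ u, rfl⟩

theorem numComponents_le_card_s11 [Finite U] (ends : F → Sym2 U) (A : Finset F) :
    numComponents ends A ≤ Nat.card U :=
  Nat.card_le_card_of_surjective _ Quot.mk_surjective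

theorem rank_mono [Finite U] (ends : F → Sym2 U) {A B : Finset F} (h : A ⊆ B) :
    rank ends A ≤ rank ends B :=
  Nat.sub_le_sub_left (numComponents_anti ends h) _

theorem edgeRel_map {F' : Type*} (ends : F → Sym2 U) (φ : F' ↪ F) (A : Finset F') :
    edgeRel ends (A.map φ) = edgeRel (fun f => ends (φ f)) A := by
  funext u v
  simp [edgeRel]

theorem rank_map {F' : Type*} (ends : F → Sym2 U) (φ : F' ↪ F) (A : Finset F') :
    rank ends (A.map φ) = rank (fun f => ends (φ f)) A := by
  rw [rank, rank, numComponents, numComponents, edgeRel_map]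

/-- Adding edges between `a` and `b` identifies `a` with `b` in the set of components. -/
def quotEdgeRelEquiv {F' : Type*} {ends : F → Sym2 U} {A : Finset F} {ends' : F' → Sym2 U}
    {B : Finset F'} {a b : U} (hab : edgeRel ends A a b)
    (hAB : ∀ u v, edgeRel ends A u v ↔ edgeRel ends' B u v ∨ s(a, b) = s(u, v)) :
    Quot (edgeRel ends A) ≃ Quot (fun u v => edgeRel ends' B u v ∨ (u = a ∧ v = b)) :=
  quotEquivOfSound
    (by
      intro u v h
      rcases (hAB u v).1 h with h | h
      · exact Quot.sound (Or.inl h)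
      · rcases Sym2.eq_iff.1 h with ⟨rfl, rfl⟩ | ⟨rfl, rfl⟩
        · exact Quot.sound (Or.inr ⟨rfl, rfl⟩)
        · symm; exact Quot.sound (Or.inr ⟨rfl, rfl⟩))
    (by
      rintro u v (h | ⟨rfl, rfl⟩)
      · exact Quot.sound ((hAB u v).2 (Or.inl h))
      · exact Quot.sound hab)

theorem card_quot_edgeRel_or_pair (ends : F → Sym2 U) (A : Finset F) (a b : U) :
    Nat.card (Quot fun u v => edgeRel ends A u v ∨ (u = a ∧ v = b))
      = Nat.card (Quot fun p q : Quot (edgeRel ends A) =>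
          p = Quot.mk _ a ∧ q = Quot.mk _ b) := by
  have h := Nat.card_congr (quotQuotEquiv (fun u v => u = a ∧ v = b) (edgeRel ends A))
  rw [map_pair] at h
  rw [h]
  simp only [or_comm]

theorem numComponents_contract (ends : F → Sym2 U) (A : Finset F) (a b : U) :
    numComponents (fun f => Sym2.map (Quot.mk fun u v : U => u = a ∧ v = b) (ends f)) A
      = Nat.card (Quot fun u v => edgeRel ends A u v ∨ (u = a ∧ v = b)) := by
  rw [← Nat.card_congr (quotQuotEquiv (edgeRel ends A) fun u v => u = a ∧ v = b), numComponents]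
  congr 2
  funext p q
  refine propext ⟨?_, ?_⟩
  · rintro ⟨f, hf, h⟩
    obtain ⟨⟨u, v⟩, huv⟩ := Quot.exists_rep (ends f)
    change s(u, v) = _ at huv
    simp only [← huv, Sym2.map_mk] at h
    rcases Sym2.eq_iff.1 h with ⟨h₁, h₂⟩ | ⟨h₁, h₂⟩
    · exact ⟨u, v, ⟨f, hf, huv.symm⟩, h₁, h₂⟩
    · exact ⟨v, u, ⟨f, hf, huv.symm.trans Sym2.eq_swap⟩, h₂, h₁⟩
  · rintro ⟨u, v, ⟨f, hf, h⟩, rfl, rfl⟩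
    exact ⟨f, hf, by simp only [h, Sym2.map_mk]⟩

theorem numComponents_le_insert_add_one [Finite U] [DecidableEq F] (ends : F → Sym2 U)
    (A : Finset F) (f : F) :
    numComponents ends A ≤ numComponents ends (insert f A) + 1 := by
  obtain ⟨⟨a, b⟩, hf⟩ := Quot.exists_rep (ends f)
  change s(a, b) = _ at hf
  rw [numComponents, numComponents,
    Nat.card_congr (quotEdgeRelEquiv (ends' := ends) (B := A) (a := a) (b := b)
      ⟨f, Finset.mem_insert_self f A, hf.symm⟩ fun u v => by
        simp [edgeRel, or_and_right, exists_or, ← hf, or_comm]),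
    card_quot_edgeRel_or_pair]
  exact card_le_card_quot_pair_add_one _ _

theorem rank_le_card [Finite U] (ends : F → Sym2 U) (A : Finset F) :
    rank ends A ≤ A.card := by
  classical
  induction A using Finset.induction_on with
  | empty =>
    have e : U ≃ Quot (edgeRel ends ∅) :=
      ⟨Quot.mk _, Quot.lift id (by simp [edgeRel]), fun u => rfl, by rintro ⟨u⟩; rfl⟩
    simp [rank, numComponents, Nat.card_congr e]
  | insert f A hf ih =>
    have := numComponents_le_insert_add_one ends A f
    rw [Finset.card_insert_of_notMem hf]
    unfold rank at *
    omega

theorem numComponents_contract_add_one [Finite U] (ends : F → Sym2 U) (A : Finset F) {a b : U}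
    (hab : Quot.mk (edgeRel ends A) a ≠ Quot.mk (edgeRel ends A) b) :
    numComponents (fun f => Sym2.map (Quot.mk fun u v : U => u = a ∧ v = b) (ends f)) A + 1
      = numComponents ends A := by
  rw [numComponents_contract, card_quot_edgeRel_or_pair, card_quot_pair_add_one hab,
    numComponents]

theorem rank_contract [Finite U] (ends : F → Sym2 U) (A : Finset F) {a b : U}
    (hab : Quot.mk (edgeRel ends A) a ≠ Quot.mk (edgeRel ends A) b) :
    rank (fun f => Sym2.map (Quot.mk fun u v : U => u = a ∧ v = b) (ends f)) A
      = rank ends A := by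
  have h₁ := numComponents_contract_add_one ends A hab
  have h₂ := card_quot_pair_add_one fun h : a = b => hab (congrArg _ h)
  unfold rank
  omega

theorem rank_disjSum_empty {F' : Type*} (ends : F → Sym2 U) (ends' : F' → Sym2 U)
    (A : Finset F) :
    rank (Sum.elim ends ends') (A.disjSum ∅) = rank ends A := by
  rw [Finset.disjSum_empty, rank_map]
  rfl

theorem rank_disjSum_parallel [Finite U] {F' : Type*} (ends : F → Sym2 U) (A : Finset F)
    {a b : U} (hab : Quot.mk (edgeRel ends A) a ≠ Quot.mk (edgeRel ends A) b)
    {C : Finset F'} (hC : C.Nonempty) :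
    rank (Sum.elim ends fun _ => s(a, b)) (A.disjSum C) = rank ends A + 1 := by
  obtain ⟨c, hc⟩ := hC
  have h₁ : numComponents (Sum.elim ends fun _ : F' => s(a, b)) (A.disjSum C) + 1
      = numComponents ends A := by
    rw [numComponents, Nat.card_congr (quotEdgeRelEquiv (ends' := ends) (B := A)
        (a := a) (b := b) ⟨Sum.inr c, by simpa using hc, rfl⟩ fun u v => by
          have : ∃ c, c ∈ C := ⟨c, hc⟩
          simp [edgeRel, Finset.mem_disjSum, this]),
      card_quot_edgeRel_or_pair, card_quot_pair_add_one hab, numComponents]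
  have h₂ := numComponents_le_card_s11 ends A
  unfold rank
  omega

end Components

section Tutte

variable {U F : Type*} [Fintype F] {R : Type*} [CommRing R]

theorem tutte_congr {F' : Type*} [Fintype F'] (φ : F' ≃ F) (ends : F → Sym2 U) (x y : R) :
    tutte ends x y = tutte (fun f => ends (φ f)) x y := by
  simp only [tutte, Finset.powerset_univ]
  refine (Fintype.sum_equiv φ.finsetCongr _ _ fun A => ?_).symm
  have huniv := rank_map ends φ.toEmbedding Finset.univ
  have hA := rank_map ends φ.toEmbedding A
  simp only [Finset.map_univ_equiv, Equiv.coe_toEmbedding] at huniv hA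
  simp [Equiv.finsetCongr_apply, huniv, hA]

theorem sum_card_sub_one (t : ℕ) (y : R) :
    ∑ C ∈ (Finset.univ : Finset (Finset (Fin t))).erase ∅, (y - 1) ^ (C.card - 1)
      = ∑ i ∈ Finset.range t, y ^ i := by
  have h := congrArg (Polynomial.eval (y - 1))
    (Polynomial.geom_sum_X_comp_X_add_one_eq_sum (R := R) t)
  simp only [Polynomial.eval_comp, Polynomial.eval_finsetSum, Polynomial.eval_pow,
    Polynomial.eval_X, Polynomial.eval_add, Polynomial.eval_one, Polynomial.eval_mul,
    Polynomial.eval_natCast, sub_add_cancel] at h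
  have hsum := Finset.sum_powerset_apply_card (x := (Finset.univ : Finset (Fin t)))
    fun k => (y - 1) ^ (k - 1)
  rw [Finset.powerset_univ, Finset.card_univ, Fintype.card_fin, Finset.sum_range_succ'] at hsum
  rw [h, Finset.sum_erase_eq_sub (Finset.mem_univ _), hsum]
  simp

/-- The Tutte polynomial after joining two components by `t` parallel edges. -/
theorem tutte_parallel_bridge [Finite U] {t : ℕ} (ht : 1 ≤ t) (ends : F → Sym2 U) {a b : U}
    (hab : Quot.mk (edgeRel ends Finset.univ) a ≠ Quot.mk (edgeRel ends Finset.univ) b)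
    (x y : R) :
    tutte (Sum.elim ends fun _ : Fin t => s(a, b)) x y
      = (∑ i ∈ Finset.range t, y ^ i) *
          tutte (fun f => Sym2.map (Quot.mk fun u v : U => u = a ∧ v = b) (ends f)) x y
        + (x - 1) * tutte ends x y := by
  have hsep (A : Finset F) : Quot.mk (edgeRel ends A) a ≠ Quot.mk (edgeRel ends A) b :=
    fun h => hab (mk_edgeRel_mono (Finset.subset_univ A) h)
  have hne : (Finset.univ : Finset (Fin t)).Nonempty := ⟨⟨0, ht⟩, Finset.mem_univ _⟩
  have huniv : rank (Sum.elim ends fun _ : Fin t => s(a, b)) Finset.univ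
      = rank ends Finset.univ + 1 := by
    rw [← Finset.univ_disjSum_univ, rank_disjSum_parallel ends _ hab hne]
  simp only [tutte, Finset.powerset_univ, huniv, rank_contract ends _ (hsep _)]
  rw [Fintype.sum_equiv Finset.sumEquiv.toEquiv _
    (fun p : Finset F × Finset (Fin t) =>
      (x - 1) ^ (rank ends Finset.univ + 1
          - rank (Sum.elim ends fun _ : Fin t => s(a, b)) (p.1.disjSum p.2)) *
        (y - 1) ^ ((p.1.disjSum p.2).card
          - rank (Sum.elim ends fun _ : Fin t => s(a, b)) (p.1.disjSum p.2)))
    fun A => by simp [Finset.sumEquiv, Finset.toLeft_disjSum_toRight],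
    Fintype.sum_prod_type, Finset.mul_sum, Finset.mul_sum, ← Finset.sum_add_distrib]
  refine Finset.sum_congr rfl fun A _ => ?_
  have hA := rank_mono ends (Finset.subset_univ A)
  have hcard := rank_le_card ends A
  rw [← Finset.sum_erase_add _ _ (Finset.mem_univ ∅), rank_disjSum_empty, Finset.card_disjSum,
    Finset.card_empty, add_zero, Nat.sub_add_comm hA, pow_succ', mul_assoc,
    ← sum_card_sub_one, Finset.sum_mul]
  congr 1
  refine Finset.sum_congr rfl fun C hC => ?_
  have hC' := Finset.nonempty_iff_ne_empty.2 (Finset.ne_of_mem_erase hC)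
  have hpos := hC'.card_pos
  rw [rank_disjSum_parallel ends A (hsep A) hC', Finset.card_disjSum, Nat.add_sub_add_right,
    show A.card + C.card - (rank ends A + 1) = (C.card - 1) + (A.card - rank ends A) by omega,
    pow_add]
  ring

end Tutte

/-- Let `G` be a finite multigraph, `t ≥ 1`, and `e` a bridge
of `G` with distinct endpoints `a, b` (deleting `e` increases the number of
connected components). Then
`T_Ĝ(x,y) = (y^{t-1} + … + y + 1)·T_{\widehat{G·e}}(x,y) + (x-1)·T_{\widehat{G-e}}(x,y)`,
where `Ĥ` replaces every edge of `H` by `t` parallel copies, `G - e` deletes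
`e`, and `G·e` contracts `e` (its endpoints are identified via the quotient of
the vertex set identifying `a` and `b`). -/
theorem tutte_hat_bridge {U E : Type} [Finite U] [Fintype E] [DecidableEq E]
    {R : Type} [CommRing R] (t : ℕ) (ht : 1 ≤ t) (ends : E → Sym2 U)
    (e : E) (a b : U) (hab : a ≠ b) (he : ends e = s(a, b))
    (hbridge : numComponents ends Finset.univ
      < numComponents ends (Finset.univ.erase e)) (x y : R) :
    tutte (V := U) (fun p : E × Fin t => ends p.1) x y
      = (∑ i ∈ Finset.range t, y ^ i) *
          tutte (V := Quot fun u v : U => u = a ∧ v = b)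
            (fun p : {f : E // f ≠ e} × Fin t =>
              Sym2.map (Quot.mk fun u v : U => u = a ∧ v = b) (ends p.1.1)) x y
        + (x - 1) *
            tutte (V := U) (fun p : {f : E // f ≠ e} × Fin t => ends p.1.1) x y := by
  have hsep : Quot.mk (edgeRel (fun p : {f : E // f ≠ e} × Fin t => ends p.1.1) Finset.univ) a
      ≠ Quot.mk (edgeRel (fun p : {f : E // f ≠ e} × Fin t => ends p.1.1) Finset.univ) b := by
    intro h
    have hle : ∀ u v, edgeRel (fun p : {f : E // f ≠ e} × Fin t => ends p.1.1) Finset.univ u v →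
        edgeRel ends (Finset.univ.erase e) u v := by
      rintro u v ⟨p, -, hp⟩
      exact ⟨p.1.1, by simp [p.1.2], hp⟩
    have h' : Quot.mk (edgeRel ends (Finset.univ.erase e)) a
        = Quot.mk (edgeRel ends (Finset.univ.erase e)) b :=
      congrArg (Quot.map id hle) h
    refine hbridge.ne (Nat.card_congr (quotEquivOfSound ?_ ?_))
    · rintro u v ⟨f, -, hf⟩
      by_cases hfe : f = e
      · rw [hfe, he] at hf
        rcases Sym2.eq_iff.1 hf with ⟨rfl, rfl⟩ | ⟨rfl, rfl⟩
        exacts [h', h'.symm]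
      · exact Quot.sound ⟨f, by simp [hfe], hf⟩
    · rintro u v ⟨f, -, hf⟩
      exact Quot.sound ⟨f, Finset.mem_univ f, hf⟩
  let φ : ({f : E // f ≠ e} × Fin t) ⊕ Fin t → E × Fin t :=
    Sum.elim (fun p => (p.1.1, p.2)) fun i => (e, i)
  have hφ : Function.Bijective φ := by
    constructor
    · rintro (⟨⟨f, hf⟩, i⟩ | i) (⟨⟨g, hg⟩, j⟩ | j) h <;> simp_all [φ]
      exact hg h.1.symm
    · rintro ⟨f, i⟩
      by_cases hf : f = e
      · exact ⟨Sum.inr i, by simp [φ, hf]⟩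
      · exact ⟨Sum.inl (⟨f, hf⟩, i), rfl⟩
  rw [tutte_congr (Equiv.ofBijective φ hφ), ← tutte_parallel_bridge ht _ hsep]
  congr 1
  funext p
  rcases p with p | i
  · rfl
  · exact he

end ForestAlg
end
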